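/- Let μ be an inner automorphism of g that is semisimple as a linear endomorphism of g. Then there exist involutions of maximal rank ϑ and ϑ' of g such that μ = ϑ∘ϑ'. -/

import Mathlib

open LieAlgebra Module

variable (k : Type*) [Field k] [IsAlgClosed k] [CharZero k]
variable (g : Type*) [LieRing g] [LieAlgebra k g] [FiniteDimensional k g]
  [LieAlgebra.IsSemisimple k g]

/-- The eigenspace of a Lie algebra automorphism `σ` for the eigenvalue `c`. -/
noncomputable def eigSub (σ : g ≃ₗ⁅k⁆ g) (c : k) : Submodule k g :=
  Module.End.eigenspace (σ.toLinearEquiv : g →ₗ[k] g) c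

/-- A Lie algebra involution: an automorphism `σ` with `σ ∘ σ = id`. -/
def IsInvolution (σ : g ≃ₗ⁅k⁆ g) : Prop := ∀ x, σ (σ x) = x

/-- Two commuting involutions. -/
def CommutingInvolutions (σ₁ σ₂ : g ≃ₗ⁅k⁆ g) : Prop :=
  IsInvolution k g σ₁ ∧ IsInvolution k g σ₂ ∧ ∀ x, σ₁ (σ₂ x) = σ₂ (σ₁ x)

/-- The subspace `g_{ij}` of the quaternionic decomposition determined by commuting
involutions `σ₁, σ₂`: here `i, j : Bool` and `false, true` encode the exponents `0, 1`
of the eigenvalues `(-1)^i`, `(-1)^j`. -/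
noncomputable def qSpace (σ₁ σ₂ : g ≃ₗ⁅k⁆ g) (i j : Bool) : Submodule k g :=
  eigSub k g σ₁ (if i then -1 else 1) ⊓ eigSub k g σ₂ (if j then -1 else 1)

/-- `x` is a semisimple element of `g`: `ad x` is a semisimple endomorphism. -/
def IsSSElt (x : g) : Prop := Module.End.IsSemisimple (ad k g x)

/-- `x` is a nilpotent element of `g`: `ad x` is a nilpotent endomorphism. -/
def IsNilpElt (x : g) : Prop := IsNilpotent (ad k g x)

/-- `x` is a regular element of `g`: the dimension of its centralizer equals the rank of `g`,
i.e. the dimension of a Cartan subalgebra of `g`. -/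
def IsRegElt (x : g) : Prop :=
  ∃ H : LieSubalgebra k g, H.IsCartanSubalgebra ∧
    Module.finrank k (LinearMap.ker (ad k g x)) = Module.finrank k H

/-- An involution is of maximal rank if its `(-1)`-eigenspace contains a Cartan
subalgebra of `g`. -/
def IsMaxRank (σ : g ≃ₗ⁅k⁆ g) : Prop :=
  ∃ H : LieSubalgebra k g, H.IsCartanSubalgebra ∧ H.toSubmodule ≤ eigSub k g σ (-1)

/-- The centralizer of an element `x`, as a Lie subalgebra of `g`. -/
def zg (x : g) : LieSubalgebra k g where
  carrier := {y | ⁅x, y⁆ = 0}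
  add_mem' := by
    intro a b ha hb
    simp only [Set.mem_setOf_eq] at *
    rw [lie_add, ha, hb, add_zero]
  zero_mem' := by simp
  smul_mem' := by
    intro t a ha
    simp only [Set.mem_setOf_eq] at *
    rw [lie_smul, ha, smul_zero]
  lie_mem' := by
    intro a b ha hb
    simp only [Set.mem_setOf_eq] at *
    rw [leibniz_lie, ha, hb, lie_zero, zero_lie, add_zero]

/-- The fixed-point subalgebra of a Lie algebra automorphism. -/
def fixSubalgebra (σ : g ≃ₗ⁅k⁆ g) : LieSubalgebra k g where
  carrier := {x | σ x = x}
  add_mem' := by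
    intro a b ha hb
    simp only [Set.mem_setOf_eq] at *
    rw [show σ (a + b) = σ a + σ b from σ.toLieHom.map_add a b, ha, hb]
  zero_mem' := by simp only [Set.mem_setOf_eq]; exact σ.toLieHom.map_zero
  smul_mem' := by
    intro t a ha
    simp only [Set.mem_setOf_eq] at *
    rw [show σ (t • a) = t • σ a from σ.toLieHom.map_smul t a, ha]
  lie_mem' := by
    intro a b ha hb
    simp only [Set.mem_setOf_eq] at *
    rw [LieEquiv.map_lie σ a b, ha, hb]

/-- The exponential of an endomorphism, as a finite sum (which is the genuine exponential
when the endomorphism is nilpotent). -/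
noncomputable def expEnd (f : Module.End k g) : Module.End k g :=
  ∑ i ∈ Finset.range (Module.finrank k g + 1), (i.factorial : k)⁻¹ • f ^ i

/-- An automorphism of `g` is inner if it lies in the subgroup of automorphisms generated
by the exponentials `exp (ad x)` with `ad x` nilpotent. -/
noncomputable def IsInnerAut (μ : g ≃ₗ⁅k⁆ g) : Prop :=
  μ.toLinearEquiv ∈ Subgroup.closure
    {e : g ≃ₗ[k] g | ∃ x : g, IsNilpotent (ad k g x) ∧
      (e : g →ₗ[k] g) = expEnd k g (ad k g x)}

/-- `σ` and `τ` are conjugate by an inner automorphism of `g`. -/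
noncomputable def InnerConj (σ τ : g ≃ₗ⁅k⁆ g) : Prop :=
  ∃ φ : g ≃ₗ⁅k⁆ g, IsInnerAut k g φ ∧ ∀ x, τ x = φ (σ (φ.symm x))

/-- A dyad: a pair of distinct commuting involutions that are conjugate by an inner
automorphism of `g`. -/
noncomputable def IsDyad (σ₁ σ₂ : g ≃ₗ⁅k⁆ g) : Prop :=
  IsInvolution k g σ₁ ∧ IsInvolution k g σ₂ ∧ σ₁ ≠ σ₂ ∧
    (∀ x, σ₁ (σ₂ x) = σ₂ (σ₁ x)) ∧ InnerConj k g σ₁ σ₂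

/-- The span of all brackets `⁅x, y⁆` with `x, y` in a subspace `m`. -/
noncomputable def bracketSpan (m : Submodule k g) : Submodule k g :=
  Submodule.span k {z | ∃ x ∈ m, ∃ y ∈ m, z = ⁅x, y⁆}

/-- `c` is a Cartan subspace of a subspace `m ⊆ g`: it consists of pairwise commuting
semisimple elements of `g` and is maximal among such subspaces of `m`. -/
def IsCartanSubspace (m c : Submodule k g) : Prop :=
  c ≤ m ∧ (∀ x ∈ c, IsSSElt k g x) ∧ (∀ x ∈ c, ∀ y ∈ c, ⁅x, y⁆ = 0) ∧
    ∀ c' : Submodule k g, c' ≤ m → (∀ x ∈ c', IsSSElt k g x) →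
      (∀ x ∈ c', ∀ y ∈ c', ⁅x, y⁆ = 0) → c ≤ c' → c' = c

theorem exp_step {A L : Type*} [CommRing A] [LieRing L] [LieAlgebra A L] [LieAlgebra ℚ L]
    (v : A) (N : ℕ) (hv : v ^ N = 0) (u : L) (n : ℕ) (hn : 1 ≤ n) :
    ∃ ψ : L ≃ₗ⁅A⁆ L, ∀ m, ∃ m', ψ m = m + v ^ n • ⁅u, m⁆ + v ^ (n + 1) • m' := by
  set D : LieDerivation A L L := v ^ n • LieDerivation.ad A L u with hD
  have hDl : D.toLinearMap = v ^ n • (LieAlgebra.ad A L u) := by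
    ext m; simp [hD]
  have hpow : ∀ i, D.toLinearMap ^ i = v ^ (n * i) • (LieAlgebra.ad A L u) ^ i := by
    intro i; rw [hDl, smul_pow, pow_mul]
  have h0 : D.toLinearMap ^ (N + 2) = 0 := by
    rw [hpow, show n * (N + 2) = N + ((n - 1) * N + 2 * n) by
      obtain ⟨j, rfl⟩ := Nat.exists_eq_add_of_le hn; simp; ring, pow_add, hv]; simp
  have hnil : IsNilpotent D.toLinearMap := ⟨_, h0⟩
  refine ⟨LieDerivation.exp D hnil, fun m => ?_⟩
  refine ⟨∑ i ∈ Finset.range N, ((i + 2).factorial : ℚ)⁻¹ •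
    (v ^ (n * (i + 2) - (n + 1)) • ((LieAlgebra.ad A L u) ^ (i + 2)) m), ?_⟩
  rw [LieDerivation.exp_map_apply, IsNilpotent.exp_eq_sum h0, Finset.sum_range_succ',
    Finset.sum_range_succ', Finset.smul_sum]
  have : ∀ i, v ^ (n * (i + 2)) = v ^ (n+1) * v ^ (n * (i + 2) - (n + 1)) := by
    intro i; rw [← pow_add]; congr 1
    have : n + 1 ≤ n * (i+2) := by nlinarith
    omega
  simp [LinearMap.sum_apply, hpow, add_assoc, this, mul_smul, smul_comm _ (v^(n+1))]
  abel

section core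
variable {A L I J : Type*} [CommRing A] [LieRing L] [LieAlgebra A L]

/-- multiples of `v ^ n`. -/
def vmul (L : Type*) [LieRing L] [LieAlgebra A L] (v : A) (n : ℕ) : Submodule A L :=
  LinearMap.range (v ^ n • (LinearMap.id : L →ₗ[A] L))

theorem mem_vmul {v : A} {n : ℕ} {x : L} : x ∈ vmul L v n ↔ ∃ m, v ^ n • m = x := by
  simp [vmul, LinearMap.mem_range]

theorem vmul_map {v : A} {n : ℕ} {x : L} (f : L →ₗ[A] L) (h : x ∈ vmul L v n) :
    f x ∈ vmul L v n := by
  obtain ⟨m, rfl⟩ := mem_vmul.1 h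
  exact mem_vmul.2 ⟨f m, by simp⟩

theorem vmul_smul {v : A} {n j : ℕ} {x : L} (h : x ∈ vmul L v j) :
    v ^ n • x ∈ vmul L v (n + j) := by
  obtain ⟨m, rfl⟩ := mem_vmul.1 h
  exact mem_vmul.2 ⟨m, by rw [pow_add, mul_smul]⟩

theorem vmul_anti {v : A} {n j : ℕ} {x : L} (hnj : n ≤ j) (h : x ∈ vmul L v j) :
    x ∈ vmul L v n := by
  obtain ⟨m, rfl⟩ := mem_vmul.1 h
  obtain ⟨i, rfl⟩ := Nat.exists_eq_add_of_le hnj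
  exact mem_vmul.2 ⟨v ^ i • m, by rw [pow_add, mul_smul]⟩

theorem vmul_self {v : A} {n : ℕ} (x : L) : v ^ n • x ∈ vmul L v n := mem_vmul.2 ⟨x, rfl⟩

theorem core_step [LieAlgebra ℚ L] (v : A) (N : ℕ) (hv : v ^ N = 0)
    (H : Submodule A L) (y : L) (τ : L →ₗ[A] L)
    (hsolve : ∀ e : L, ∃ u : L, e + τ ⁅u, y⁆ - ⁅u, y⁆ ∈ H)
    (n : ℕ) (hn : 1 ≤ n) (Φ : L ≃ₗ⁅A⁆ L) (hΦ : ∀ x, Φ x - τ x ∈ vmul L v 1)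
    (hy : ∃ η ∈ H, η - y ∈ vmul L v 1 ∧ Φ y - η ∈ vmul L v n) :
    ∃ ψ : L ≃ₗ⁅A⁆ L, (∀ x, ψ.symm (Φ (ψ x)) - τ x ∈ vmul L v 1) ∧
      ∃ η ∈ H, η - y ∈ vmul L v 1 ∧ ψ.symm (Φ (ψ y)) - η ∈ vmul L v (n + 1) := by
  obtain ⟨η, hηH, hηy, he⟩ := hy
  obtain ⟨e, he⟩ := mem_vmul.1 he
  obtain ⟨u, hu⟩ := hsolve e
  obtain ⟨ψ, hψ⟩ := exp_step v N hv u n hn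
  have hψ' : ∀ m, ψ m - (m + v ^ n • ⁅u, m⁆) ∈ vmul L v (n + 1) := by
    intro m; obtain ⟨m', h⟩ := hψ m; rw [h]; simpa using vmul_self m'
  have hψ1 : ∀ m, ψ m - m ∈ vmul L v 1 := by
    intro m
    have := (vmul L v 1).add_mem (vmul_anti (by omega) (hψ' m))
      (vmul_anti hn (vmul_self (v := v) (n := n) ⁅u, m⁆))
    convert this using 1; abel
  have hsymm : ∀ (j : ℕ) (p q : L), p - ψ q ∈ vmul L v j → ψ.symm p - q ∈ vmul L v j := by
    intro j p q h
    have := vmul_map (ψ.symm.toLinearEquiv : L →ₗ[A] L) h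
    have h2 : (ψ.symm.toLinearEquiv : L →ₗ[A] L) (p - ψ q) = ψ.symm p - q := by
      rw [map_sub]
      show ψ.symm p - ψ.symm (ψ q) = _
      rw [LieEquiv.symm_apply_apply]
    rwa [h2] at this
  refine ⟨ψ, fun x => hsymm 1 _ _ ?_, η + v ^ n • (e + τ ⁅u, y⁆ - ⁅u, y⁆),
    H.add_mem hηH (H.smul_mem _ hu), ?_, hsymm (n + 1) _ _ ?_⟩
  · have h1 := vmul_map (Φ.toLinearEquiv : L →ₗ[A] L) (hψ1 x)
    rw [map_sub] at h1
    change Φ (ψ x) - Φ x ∈ _ at h1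
    have := (vmul L v 1).sub_mem ((vmul L v 1).add_mem h1 (hΦ x)) (hψ1 (τ x))
    convert this using 1; abel
  · have := (vmul L v 1).add_mem hηy (vmul_anti hn (vmul_self (v := v) (n := n)
      (e + τ ⁅u, y⁆ - ⁅u, y⁆)))
    convert this using 1; abel
  · set h := e + τ ⁅u, y⁆ - ⁅u, y⁆ with hh
    have h1 := vmul_map (Φ.toLinearEquiv : L →ₗ[A] L) (hψ' y)
    rw [map_sub, map_add, map_smul] at h1
    change Φ (ψ y) - (Φ y + v ^ n • Φ ⁅u, y⁆) ∈ _ at h1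
    have h2 := vmul_smul (n := n) (hΦ ⁅u, y⁆)
    have h3 := hψ' (η + v ^ n • h)
    have h4 : η + v ^ n • h - y ∈ vmul L v 1 := by
      have := (vmul L v 1).add_mem hηy (vmul_anti hn (vmul_self (v := v) (n := n) h))
      convert this using 1; abel
    have h5 := vmul_smul (n := n) (vmul_map (LieAlgebra.ad A L u) h4)
    rw [map_sub] at h5
    simp only [LieAlgebra.ad_apply] at h5
    have := (vmul L v (n + 1)).sub_mem ((vmul L v (n + 1)).add_mem h1 h2)
      ((vmul L v (n + 1)).add_mem h3 h5)
    convert this using 1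
    have hΦy : Φ y = η + v ^ n • e := by rw [he]; abel
    rw [hΦy, hh]
    simp only [smul_sub, smul_add, lie_add, lie_sub, lie_smul]
    abel

theorem core_iter [LieAlgebra ℚ L] (v : A) (N : ℕ) (hv : v ^ N = 0)
    (H : Submodule A L) (y : L) (hyH : y ∈ H) (τ : L →ₗ[A] L) (hτy : τ y = y)
    (hsolve : ∀ e : L, ∃ u : L, e + τ ⁅u, y⁆ - ⁅u, y⁆ ∈ H)
    (Φ : L ≃ₗ⁅A⁆ L) (hΦ : ∀ x, Φ x - τ x ∈ vmul L v 1) (n : ℕ) :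
    ∃ ψ : L ≃ₗ⁅A⁆ L, (∀ x, ψ.symm (Φ (ψ x)) - τ x ∈ vmul L v 1) ∧
      ∃ η ∈ H, η - y ∈ vmul L v 1 ∧ ψ.symm (Φ (ψ y)) - η ∈ vmul L v (n + 1) := by
  induction n with
  | zero =>
    refine ⟨LieEquiv.refl, fun x => hΦ x, y, hyH, by simp, ?_⟩
    have := hΦ y
    rw [hτy] at this
    exact this
  | succ n ih =>
    obtain ⟨ψ, h1, h2⟩ := ih
    obtain ⟨ψ', h1', h2'⟩ := core_step v N hv H y τ hsolve (n + 1) (by omega)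
      ((ψ.trans Φ).trans ψ.symm) h1 h2
    exact ⟨ψ'.trans ψ, h1', h2'⟩

theorem core_final [Fintype I] [Fintype J] [DecidableEq I] (b : Basis (I ⊕ J) A L) (a : I → J → A)
    (hHH : ∀ i i', ⁅b (.inl i), b (.inl i')⁆ = 0)
    (hHJ : ∀ i j, ⁅b (.inl i), b (.inr j)⁆ = a i j • b (.inr j))
    (Y : I → A) (hY : ∀ j, IsUnit (∑ i, Y i * a i j))
    (B : J → I → A) (hB : ∀ i i', ∑ j, a i j * B j i' = if i = i' then 1 else 0)
    (s : J → A) (hs : ∀ j, IsUnit (s j)) 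
    (v : A) (N : ℕ) (hv : v ^ N = 0) (Φ : L ≃ₗ⁅A⁆ L) 
    (h2 : ∀ j, Φ (b (.inr j)) - s j • b (.inr j) ∈ vmul L v 1)
    (h3 : Φ (∑ i, Y i • b (.inl i)) - ∑ i, Y i • b (.inl i) ∈ vmul L v 1)
    (h4 : Φ (∑ i, Y i • b (.inl i)) ∈ Submodule.span A (Set.range fun i => b (.inl i))) (i : I) :
    Φ (b (.inl i)) = b (.inl i) := by
  set H := Submodule.span A (Set.range fun i => b (.inl i)) with hH
  have hHmem : ∀ x, (∀ j, b.repr x (.inr j) = 0) → x = ∑ i, b.repr x (.inl i) • b (.inl i) := by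
    intro x hx
    conv_lhs => rw [← b.sum_repr x]
    rw [Fintype.sum_sum_type]
    simp [hx]
  have hHmem' : ∀ x ∈ H, ∀ j, b.repr x (.inr j) = 0 := by
    intro x hx j
    induction hx using Submodule.span_induction with
    | mem x h => obtain ⟨i, rfl⟩ := h; simp
    | zero => simp
    | add x y _ _ h h' => simp [h, h']
    | smul c x _ h => simp [h]
  have hbr : ∀ i x j, b.repr ⁅b (.inl i), x⁆ (.inr j) = a i j * b.repr x (.inr j) := by
    intro i x j
    have : (b.coord (.inr j)) ∘ₗ (LieAlgebra.ad A L (b (.inl i))) = a i j • b.coord (.inr j) := by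
      refine b.ext ?_
      rintro (i' | j')
      · simp [hHH]
      · simp only [LinearMap.coe_comp, Function.comp_apply, ad_apply, hHJ, map_smul, 
          LinearMap.smul_apply]
        classical
        simp only [Basis.coord_apply, Basis.repr_self, Finsupp.single_apply, smul_eq_mul]
        split_ifs with h
        · cases h; rfl
        · simp
    exact congrArg (fun f => f x) this
  have hbr' : ∀ h x j, (∀ j, b.repr h (.inr j) = 0) →
      b.repr ⁅h, x⁆ (.inr j) = (∑ i, b.repr h (.inl i) * a i j) * b.repr x (.inr j) := by
    intro h x j hh
    conv_lhs => rw [hHmem h hh]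
    simp [sum_lie, smul_lie, hbr, Finset.sum_mul, mul_assoc, Finsupp.finsetSum_apply]
  have hvn : ∀ c : A, IsNilpotent (v * c) := fun c => (Commute.all v c).isNilpotent_mul_right ⟨N, hv⟩
  have hunit : ∀ (p q : A), IsUnit q → (∃ c, p = q + v * c) → IsUnit p := by
    rintro p q hq ⟨c, rfl⟩
    exact (hvn c).isUnit_add_left_of_commute hq (Commute.all _ _)
  set y := ∑ i, Y i • b (.inl i) with hy
  have hη := hHmem' _ h4
  have hyr : ∀ i, b.repr y (.inl i) = Y i := by
    intro i; classical
    simp [hy, Finsupp.single_apply]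
  have hwη : ∀ j, IsUnit (∑ i, b.repr (Φ y) (.inl i) * a i j) := by
    intro j
    refine hunit _ _ (hY j) ?_
    obtain ⟨m, hm⟩ := mem_vmul.1 h3
    have : Φ y = y + v • m := by rw [pow_one] at hm; rw [hm]; abel
    refine ⟨∑ i, b.repr m (.inl i) * a i j, ?_⟩
    rw [this, Finset.mul_sum, ← Finset.sum_add_distrib]
    refine Finset.sum_congr rfl fun i _ => ?_
    rw [map_add, map_smul, Finsupp.add_apply, hyr]
    simp; ring
  have hin : ∀ i j, b.repr (Φ (b (.inl i))) (.inr j) = 0 := by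
    intro i j
    have h0 : ⁅Φ y, Φ (b (.inl i))⁆ = 0 := by
      rw [← LieEquiv.map_lie, hy, sum_lie]
      simp [hHH]
    have := hbr' _ (Φ (b (.inl i))) j hη
    rw [h0, map_zero, Finsupp.zero_apply] at this
    simpa using ((hwη j).mul_right_eq_zero.1 this.symm)
  have hw : ∀ i j, ∑ i', b.repr (Φ (b (.inl i))) (.inl i') * a i' j = a i j := by
    intro i j
    have h0 := hbr' _ (Φ (b (.inr j))) j (hin i)
    rw [← LieEquiv.map_lie, hHJ] at h0
    have : Φ (a i j • b (.inr j)) = a i j • Φ (b (.inr j)) := Φ.toLinearEquiv.map_smul _ _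
    rw [this, map_smul] at h0
    have hu : IsUnit (b.repr (Φ (b (.inr j))) (.inr j)) := by
      refine hunit _ _ (hs j) ?_
      obtain ⟨m, hm⟩ := mem_vmul.1 (h2 j)
      have : Φ (b (.inr j)) = s j • b (.inr j) + v • m := by rw [pow_one] at hm; rw [hm]; abel
      exact ⟨b.repr m (.inr j), by rw [this]; simp⟩
    exact (hu.mul_right_cancel h0).symm
  rw [hHmem _ (hin i)]
  have : ∀ i', b.repr (Φ (b (.inl i))) (.inl i') = if i = i' then 1 else 0 := by
    intro i'
    rw [← hB i i']
    simp_rw [← hw i, Finset.sum_mul]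
    rw [Finset.sum_comm]
    simp_rw [mul_assoc, ← Finset.mul_sum, hB]
    simp
  simp [this]

theorem core_all [LieAlgebra ℚ L] [Fintype I] [Fintype J] [DecidableEq I]
    (b : Basis (I ⊕ J) A L) (a : I → J → A)
    (hHH : ∀ i i', ⁅b (.inl i), b (.inl i')⁆ = 0)
    (hHJ : ∀ i j, ⁅b (.inl i), b (.inr j)⁆ = a i j • b (.inr j))
    (Y : I → A) (hY : ∀ j, IsUnit (∑ i, Y i * a i j))
    (B : J → I → A) (hB : ∀ i i', ∑ j, a i j * B j i' = if i = i' then 1 else 0)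
    (s : J → A) (hs : ∀ j, IsUnit (s j)) (hs1 : ∀ j, IsUnit (s j - 1))
    (v : A) (N : ℕ) (hv : v ^ N = 0) (Φ : L ≃ₗ⁅A⁆ L)
    (h1 : ∀ i, Φ (b (.inl i)) - b (.inl i) ∈ vmul L v 1)
    (h2 : ∀ j, Φ (b (.inr j)) - s j • b (.inr j) ∈ vmul L v 1) :
    ∃ ψ : L ≃ₗ⁅A⁆ L, ∀ i, ψ.symm (Φ (ψ (b (.inl i)))) = b (.inl i) := by
  set H := Submodule.span A (Set.range fun i => b (.inl i)) with hH
  set y := ∑ i, Y i • b (.inl i) with hy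
  set τ : L →ₗ[A] L := b.constr A (Sum.elim (fun i => b (.inl i)) (fun j => s j • b (.inr j)))
    with hτ
  have hτi : ∀ i, τ (b (.inl i)) = b (.inl i) := fun i => by
    rw [hτ, Basis.constr_basis]; rfl
  have hτj : ∀ j, τ (b (.inr j)) = s j • b (.inr j) := fun i => by
    rw [hτ, Basis.constr_basis]; rfl
  have hyH : y ∈ H := Submodule.sum_mem _ fun i _ => Submodule.smul_mem _ _
    (Submodule.subset_span ⟨i, rfl⟩)
  have hτy : τ y = y := by simp [hy, hτi]
  have hΦ : ∀ x, Φ x - τ x ∈ vmul L v 1 := by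
    intro x
    have hx : x ∈ Submodule.span A (Set.range b) := by rw [b.span_eq]; trivial
    induction hx using Submodule.span_induction with
    | mem x h =>
      obtain ⟨(i | j), rfl⟩ := h
      · rw [hτi]; exact h1 i
      · rw [hτj]; exact h2 j
    | zero =>
      have : Φ 0 = 0 := Φ.toLinearEquiv.map_zero
      rw [this, map_zero, sub_zero]; exact Submodule.zero_mem _
    | add x x' _ _ h h' =>
      have : Φ (x + x') = Φ x + Φ x' := Φ.toLinearEquiv.map_add _ _
      rw [this, map_add]
      convert Submodule.add_mem _ h h' using 1; abel
    | smul c x _ h =>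
      have : Φ (c • x) = c • Φ x := Φ.toLinearEquiv.map_smul _ _
      rw [this, map_smul, ← smul_sub]
      exact Submodule.smul_mem _ _ h
  have hyj : ∀ j, ⁅b (.inr j), y⁆ = -((∑ i, Y i * a i j) • b (.inr j)) := by
    intro j
    rw [← lie_skew, hy, sum_lie, Finset.sum_smul]
    simp [smul_lie, hHJ, mul_smul]
  have hsolve : ∀ e : L, ∃ u : L, e + τ ⁅u, y⁆ - ⁅u, y⁆ ∈ H := by
    intro e
    have hx : e ∈ Submodule.span A (Set.range b) := by rw [b.span_eq]; trivial
    induction hx using Submodule.span_induction with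
    | mem x h =>
      obtain ⟨(i | j), rfl⟩ := h
      · exact ⟨0, by simpa using (Submodule.subset_span ⟨i, rfl⟩ : b (.inl i) ∈ H)⟩
      · obtain ⟨c, hc⟩ := (hY j).mul (hs1 j)
        refine ⟨(↑c⁻¹ : A) • b (.inr j), ?_⟩
        have : b (.inr j) + τ ⁅(↑c⁻¹ : A) • b (.inr j), y⁆ - ⁅(↑c⁻¹ : A) • b (.inr j), y⁆ = 0 := by
          rw [smul_lie, hyj]
          simp only [map_smul, map_neg, hτj]
          have : (↑c⁻¹ : A) * ((∑ i, Y i * a i j) * (s j - 1)) = 1 := by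
            rw [← hc]; simp
          calc _ = b (.inr j) - ((↑c⁻¹ : A) * ((∑ i, Y i * a i j) * (s j - 1))) • b (.inr j) := by
                simp only [smul_neg, smul_smul]
                module
            _ = 0 := by rw [this]; simp
        rw [this]; exact Submodule.zero_mem _
    | zero => exact ⟨0, by simp⟩
    | add x x' _ _ h h' =>
      obtain ⟨u, hu⟩ := h
      obtain ⟨u', hu'⟩ := h'
      refine ⟨u + u', ?_⟩
      convert Submodule.add_mem _ hu hu' using 1
      simp only [add_lie, map_add]; abel
    | smul c x _ h =>
      obtain ⟨u, hu⟩ := h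
      refine ⟨c • u, ?_⟩
      convert Submodule.smul_mem _ c hu using 1
      simp only [smul_lie, map_smul, smul_sub, smul_add]
  obtain ⟨ψ, hψ, η, hη, hηy, hηΦ⟩ := core_iter v N hv H y hyH τ hτy hsolve Φ hΦ N
  have hηΦ' : ψ.symm (Φ (ψ y)) = η := by
    obtain ⟨m, hm⟩ := mem_vmul.1 hηΦ
    rw [pow_succ, hv] at hm
    rw [← sub_eq_zero, ← hm]; simp
  refine ⟨ψ, fun i => core_final b a hHH hHJ Y hY B hB s hs v N hv ((ψ.trans Φ).trans ψ.symm)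
    (fun j => ?_) ?_ ?_ i⟩
  · have := hψ (b (.inr j)); rw [hτj] at this; exact this
  · have := hψ y; rw [hτy] at this; exact this
  · change ψ.symm (Φ (ψ y)) ∈ H
    rw [hηΦ']; exact hη

open Polynomial in
theorem dvd_charpoly_of_fix [Fintype I] [Fintype J] [Module.Finite A L] [Module.Free A L] 
    (b : Basis (I ⊕ J) A L) (f : L →ₗ[A] L) (h : ∀ i, f (b (.inl i)) = b (.inl i)) :
    (X - 1 : A[X]) ^ Fintype.card I ∣ f.charpoly := by
  classical
  rw [← LinearMap.charpoly_toMatrix f b]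
  set M := LinearMap.toMatrix b b f
  have h11 : M.toBlocks₁₁ = 1 := by
    ext i i'
    simp [M, Matrix.toBlocks₁₁, LinearMap.toMatrix_apply, h, Finsupp.single_apply, Matrix.one_apply,
      eq_comm]
  have h21 : M.toBlocks₂₁ = 0 := by
    ext i i'
    simp [M, Matrix.toBlocks₂₁, LinearMap.toMatrix_apply, h]
  rw [← Matrix.fromBlocks_toBlocks M, h11, h21, Matrix.charpoly_fromBlocks_zero₂₁]
  rw [Matrix.charpoly_one]
  exact Dvd.intro _ rfl

open Polynomial in
theorem core_dvd [LieAlgebra ℚ L] [Fintype I] [Fintype J] [DecidableEq I]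
    [Module.Finite A L] [Module.Free A L] 
    (b : Basis (I ⊕ J) A L) (a : I → J → A)
    (hHH : ∀ i i', ⁅b (.inl i), b (.inl i')⁆ = 0)
    (hHJ : ∀ i j, ⁅b (.inl i), b (.inr j)⁆ = a i j • b (.inr j))
    (Y : I → A) (hY : ∀ j, IsUnit (∑ i, Y i * a i j))
    (B : J → I → A) (hB : ∀ i i', ∑ j, a i j * B j i' = if i = i' then 1 else 0)
    (s : J → A) (hs : ∀ j, IsUnit (s j)) (hs1 : ∀ j, IsUnit (s j - 1))
    (v : A) (N : ℕ) (hv : v ^ N = 0) (Φ : L ≃ₗ⁅A⁆ L)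
    (h1 : ∀ i, Φ (b (.inl i)) - b (.inl i) ∈ vmul L v 1)
    (h2 : ∀ j, Φ (b (.inr j)) - s j • b (.inr j) ∈ vmul L v 1) :
    (X - 1 : A[X]) ^ Fintype.card I ∣ (Φ.toLinearEquiv : L →ₗ[A] L).charpoly := by
  obtain ⟨ψ, hψ⟩ := core_all b a hHH hHJ Y hY B hB s hs hs1 v N hv Φ h1 h2
  rw [← LinearEquiv.charpoly_conj ψ.symm.toLinearEquiv]
  exact dvd_charpoly_of_fix b _ hψ
end core

/-- rational structure from a rational base ring. -/
@[reducible] def ratLie (A L : Type*) [CommRing A] [Algebra ℚ A] [LieRing L] [LieAlgebra A L] :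
    LieAlgebra ℚ L :=
  { Module.compHom L (algebraMap ℚ A) with
    lie_smul := fun q x y => lie_smul (algebraMap ℚ A q) x y }

open TensorProduct in
/-- base change of a Lie equivalence. -/
noncomputable def bcLie (R A L : Type*) [CommRing R] [CommRing A] [Algebra R A] [LieRing L] [LieAlgebra R L]
    (Φ : L ≃ₗ⁅R⁆ L) : (A ⊗[R] L) ≃ₗ⁅A⁆ (A ⊗[R] L) :=
  { Φ.toLinearEquiv.baseChange R A L L with
    map_lie' := by
      intro x y
      change (Φ.toLinearEquiv.baseChange R A L L) ⁅x, y⁆ =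
        ⁅(Φ.toLinearEquiv.baseChange R A L L) x, (Φ.toLinearEquiv.baseChange R A L L) y⁆
      induction x with
      | zero => simp
      | add x x' h h' => simp only [add_lie, map_add, h, h']
      | tmul a x =>
        induction y with
        | zero => simp
        | add x x' h h' => simp only [lie_add, map_add, h, h']
        | tmul b y => 
          simp only [ExtendScalars.bracket_tmul, LinearEquiv.baseChange_tmul]
          congr 1
          exact Φ.map_lie x y }

open TensorProduct in
theorem bcLie_tmul (R A L : Type*) [CommRing R] [CommRing A] [Algebra R A] [LieRing L]
    [LieAlgebra R L] (Φ : L ≃ₗ⁅R⁆ L) (a : A) (x : L) : bcLie R A L Φ (a ⊗ₜ x) = a ⊗ₜ Φ x := rfl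

open Polynomial TensorProduct in
theorem core_domain {R L I J : Type*} [CommRing R] [IsDomain R] [IsNoetherianRing R] [Algebra ℚ R]
    [LieRing L] [LieAlgebra R L] [Fintype I] [Fintype J] [DecidableEq I]
    [Module.Finite R L] [Module.Free R L] 
    (b : Basis (I ⊕ J) R L) (a : I → J → R)
    (hHH : ∀ i i', ⁅b (.inl i), b (.inl i')⁆ = 0)
    (hHJ : ∀ i j, ⁅b (.inl i), b (.inr j)⁆ = a i j • b (.inr j))
    (Y : I → R) (hY : ∀ j, IsUnit (∑ i, Y i * a i j))
    (B : J → I → R) (hB : ∀ i i', ∑ j, a i j * B j i' = if i = i' then 1 else 0)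
    (s : J → R) (hs : ∀ j, IsUnit (s j)) (hs1 : ∀ j, IsUnit (s j - 1))
    (v : R) (hv : ¬ IsUnit v) (Φ : L ≃ₗ⁅R⁆ L)
    (h1 : ∀ i, Φ (b (.inl i)) - b (.inl i) ∈ vmul L v 1)
    (h2 : ∀ j, Φ (b (.inr j)) - s j • b (.inr j) ∈ vmul L v 1) :
    (X - 1 : R[X]) ^ Fintype.card I ∣ (Φ.toLinearEquiv : L →ₗ[R] L).charpoly := by
  have hmon : ((X - 1 : R[X]) ^ Fintype.card I).Monic := by
    have : (X - C 1 : R[X]).Monic := monic_X_sub_C 1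
    simpa using this.pow (Fintype.card I)
  rw [← Polynomial.modByMonic_eq_zero_iff_dvd hmon]
  set p := (Φ.toLinearEquiv : L →ₗ[R] L).charpoly with hp
  have key : ∀ N : ℕ, (p %ₘ (X - 1 : R[X]) ^ Fintype.card I).map
      (algebraMap R (R ⧸ Ideal.span {v ^ N})) = 0 := by
    intro N
    rcases subsingleton_or_nontrivial (R ⧸ Ideal.span {v ^ N}) with hsub | hnt
    · exact Subsingleton.elim _ _
    rw [Polynomial.map_modByMonic _ hmon, Polynomial.modByMonic_eq_zero_iff_dvd (hmon.map _), hp,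
      ← LinearMap.charpoly_baseChange]
    simp only [Polynomial.map_pow, Polynomial.map_sub, Polynomial.map_X, Polynomial.map_one]
    set A := R ⧸ Ideal.span {v ^ N} with hA
    letI : LieAlgebra ℚ (A ⊗[R] L) := ratLie A (A ⊗[R] L)
    have hsm : ∀ (r : R) (x : L), (1 : A) ⊗ₜ[R] (r • x) = (algebraMap R A r) • ((1 : A) ⊗ₜ[R] x) := by
      intro r x
      rw [TensorProduct.tmul_smul, algebraMap_smul]
    have hvm : ∀ x : L, x ∈ vmul L v 1 → (1 : A) ⊗ₜ[R] x ∈ vmul (A ⊗[R] L) (algebraMap R A v) 1 := by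
      intro x hx
      obtain ⟨m, rfl⟩ := mem_vmul.1 hx
      exact mem_vmul.2 ⟨1 ⊗ₜ m, by rw [hsm]; simp⟩
    refine core_dvd (b.baseChange A) (fun i j => algebraMap R A (a i j)) ?_ ?_
      (fun i => algebraMap R A (Y i)) ?_ (fun i j => algebraMap R A (B i j)) ?_
      (fun j => algebraMap R A (s j)) (fun j => (hs j).map _) ?_ (algebraMap R A v) N ?_
      (bcLie R A L Φ) ?_ ?_
    · intro i i'; simp [Basis.baseChange_apply, hHH]
    · intro i j; simp only [Basis.baseChange_apply, ExtendScalars.bracket_tmul, hHJ, mul_one, hsm]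
    · intro j; have := (hY j).map (algebraMap R A); simpa using this
    · intro i i'; have := congrArg (algebraMap R A) (hB i i')
      simpa [apply_ite (algebraMap R A)] using this
    · intro j; have := (hs1 j).map (algebraMap R A); simpa using this
    · rw [← map_pow]; exact Ideal.Quotient.eq_zero_iff_mem.2 (Ideal.mem_span_singleton_self _)
    · intro i
      have := hvm _ (h1 i)
      simpa only [Basis.baseChange_apply, bcLie_tmul, TensorProduct.tmul_sub] using this
    · intro j
      have := hvm _ (h2 j)
      simpa only [Basis.baseChange_apply, bcLie_tmul, TensorProduct.tmul_sub, hsm] using this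
  ext n
  rw [coeff_zero]
  have : (p %ₘ (X - 1 : R[X]) ^ Fintype.card I).coeff n ∈ ⨅ i : ℕ, Ideal.span {v} ^ i := by
    rw [Ideal.mem_iInf]
    intro i
    have := congrArg (fun q => q.coeff n) (key i)
    simp only [coeff_map, coeff_zero] at this
    rw [Ideal.span_singleton_pow]
    exact Ideal.Quotient.eq_zero_iff_mem.1 this
  rw [Ideal.iInf_pow_eq_bot_of_isDomain _ (by rwa [Ne, Ideal.span_singleton_eq_top])] at this
  exact this

universe w

open Polynomial in
theorem exists_path_ring {k : Type w} [Field k] (u : k) (hu : u ≠ 0) :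
    ∃ (R : Type w) (_ : CommRing R) (_ : IsDomain R) (_ : IsNoetherianRing R) (_ : Algebra k R)
      (v : R) (ε0 ε1 : R →ₐ[k] k) (q1 q2 : Rˣ), ε0 v = 0 ∧ ε1 v = 1 ∧ ε0 q1 = 1 ∧ ε1 q1 = u ∧
      ε0 q2 = u ∧ ε1 q2 = 1 ∧ ∀ r, ε0 r = 0 → ∃ r', r = v * r' := by
  let p1 : k[X] := 1 + X * C (u - 1)
  let p2 : k[X] := C u + X * C (1 - u)
  let p := p1 * p2
  have hp0 : p.eval 0 = u := by simp [p, p1, p2]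
  have hp1 : p.eval 1 = u := by simp [p, p1, p2]
  have hpne : p ≠ 0 := by intro h; rw [h] at hp0; simp at hp0; exact hu hp0.symm
  let R := Localization.Away p
  have hle : Submonoid.powers p ≤ nonZeroDivisors k[X] := powers_le_nonZeroDivisors_of_noZeroDivisors hpne
  have hdom : IsDomain R := IsLocalization.isDomain_localization hle
  have hnoe : IsNoetherianRing R := IsLocalization.isNoetherianRing (Submonoid.powers p) R inferInstance
  have hunit : ∀ c : k, p.eval c = u → ∀ y : Submonoid.powers p, IsUnit (aeval c (y : k[X])) := by
    rintro c hc ⟨_, n, rfl⟩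
    simp [coe_aeval_eq_eval, hc, hu]
  let ε : ∀ c : k, p.eval c = u → R →ₐ[k] k := fun c hc =>
    IsLocalization.liftAlgHom (M := Submonoid.powers p) (f := aeval c) (hunit c hc)
  have hε : ∀ c hc (q : k[X]), ε c hc (algebraMap k[X] R q) = q.eval c := by
    intro c hc q
    simp [ε, IsLocalization.liftAlgHom_apply, coe_aeval_eq_eval]
  have hpu : IsUnit (algebraMap k[X] R p) :=
    IsLocalization.map_units R (⟨p, Submonoid.mem_powers p⟩ : Submonoid.powers p)
  have hpu' : IsUnit (algebraMap k[X] R p1 * algebraMap k[X] R p2) := by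
    rw [← map_mul]; exact hpu
  refine ⟨R, inferInstance, hdom, hnoe, inferInstance, algebraMap k[X] R X, ε 0 hp0, ε 1 hp1,
    (isUnit_of_mul_isUnit_left hpu').unit, (isUnit_of_mul_isUnit_right hpu').unit, ?_, ?_, ?_, ?_,
    ?_, ?_, ?_⟩
  any_goals simp [hε, p1, p2]
  intro r hr
  obtain ⟨⟨q, s⟩, hqs⟩ := IsLocalization.surj (Submonoid.powers p) r
  obtain ⟨s', hs'⟩ := IsLocalization.map_units R s
  simp only at hqs
  have : q.eval 0 = 0 := by
    rw [← hε 0 hp0, ← hqs, map_mul, hr, zero_mul]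
  obtain ⟨q', rfl⟩ : X ∣ q := by rwa [X_dvd_iff, coeff_zero_eq_eval_zero]
  refine ⟨algebraMap k[X] R q' * (↑s'⁻¹ : R), ?_⟩
  rw [← mul_assoc, ← map_mul, ← hqs, ← hs', mul_assoc, Units.mul_inv, mul_one]

theorem exp_abs {R L : Type*} [CommRing R] [Algebra ℚ R] [LieRing L] [LieAlgebra R L] (v : R)
    (X : L) (n : ℕ) (hn : (LieAlgebra.ad R L X) ^ n = 0) : ∃ F : L ≃ₗ⁅R⁆ L, ∀ m, F m =
      ∑ i ∈ Finset.range n, (algebraMap ℚ R (i.factorial : ℚ)⁻¹) • v ^ i •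
        ((LieAlgebra.ad R L X) ^ i) m := by
  let _ : LieAlgebra ℚ L := ratLie R L
  set D : LieDerivation R L L := v • LieDerivation.ad R L X with hD
  have hDl : D.toLinearMap = v • (LieAlgebra.ad R L X) := by
    ext m; simp [hD]
  have hpow : ∀ i, D.toLinearMap ^ i = v ^ i • (LieAlgebra.ad R L X) ^ i := by
    intro i; rw [hDl, smul_pow]
  have hz : D.toLinearMap ^ n = 0 := by rw [hpow, hn, smul_zero]
  have hnil : IsNilpotent D.toLinearMap := ⟨_, hz⟩
  refine ⟨LieDerivation.exp D hnil, fun m => ?_⟩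
  rw [LieDerivation.exp_map_apply, IsNilpotent.exp_eq_sum hz, LinearMap.sum_apply]
  refine Finset.sum_congr rfl fun i _ => ?_
  rw [LinearMap.smul_apply, hpow, LinearMap.smul_apply]
  rfl

section spec
open TensorProduct
variable {k R g : Type*} [Field k] [CommRing R] [Algebra k R] [LieRing g] [LieAlgebra k g]

/-- specialisation -/
noncomputable def specm (g : Type*) [LieRing g] [LieAlgebra k g] (ε : R →ₐ[k] k) : (R ⊗[k] g) →ₗ[k] g :=
  (TensorProduct.lid k g).toLinearMap ∘ₗ LinearMap.rTensor g ε.toLinearMap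

@[simp] theorem specm_tmul (ε : R →ₐ[k] k) (r : R) (x : g) : specm g ε (r ⊗ₜ x) = ε r • x := by
  simp [specm]

theorem specm_smul (ε : R →ₐ[k] k) (r : R) (m : R ⊗[k] g) : specm g ε (r • m) = ε r • specm g ε m := by
  induction m with
  | zero => simp
  | add x y h h' => simp only [smul_add, map_add, h, h']
  | tmul a x => simp [TensorProduct.smul_tmul', mul_smul]

theorem specm_lie (ε : R →ₐ[k] k) (x : g) (m : R ⊗[k] g) :
    specm g ε ⁅(1 : R) ⊗ₜ[k] x, m⁆ = ⁅x, specm g ε m⁆ := by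
  induction m with
  | zero => simp
  | add x y h h' => simp only [lie_add, map_add, h, h']
  | tmul a y => simp

theorem specm_repr {ι : Type*} (ε : R →ₐ[k] k) (b : Basis ι k g) (m : R ⊗[k] g) (i : ι) :
    b.repr (specm g ε m) i = ε ((b.baseChange R).repr m i) := by
  induction m with
  | zero => simp
  | add x y h h' => simp only [map_add, Finsupp.add_apply, h, h']
  | tmul a y => simp [Basis.baseChange_repr_tmul, mul_comm]

theorem specm_zero_mem {ι : Type*} [Fintype ι] (ε : R →ₐ[k] k) (v : R)
    (hv : ∀ r, ε r = 0 → ∃ r', r = v * r') (b : Basis ι k g) (m : R ⊗[k] g) (h : specm g ε m = 0) :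
    m ∈ vmul (R ⊗[k] g) v 1 := by
  have : ∀ i, ∃ r', (b.baseChange R).repr m i = v * r' := by
    intro i; apply hv; rw [← specm_repr, h]; simp
  choose r' hr' using this
  refine mem_vmul.2 ⟨∑ i, r' i • b.baseChange R i, ?_⟩
  rw [← (b.baseChange R).sum_repr m, Finset.smul_sum]
  refine Finset.sum_congr rfl fun i _ => ?_
  rw [hr', mul_smul, pow_one]

theorem pow_finrank_zero [FiniteDimensional k g] (f : Module.End k g) (h : IsNilpotent f) :
    f ^ (finrank k g) = 0 := by
  have := LinearMap.aeval_self_charpoly f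
  rw [(LinearMap.charpoly_eq_X_pow_iff f).2 ?_] at this
  · simpa using this
  · obtain ⟨n, hn⟩ := h
    exact fun m => ⟨n, by rw [hn]; rfl⟩

theorem exp_path [CharZero k] [FiniteDimensional k g] (v : R) (ε0 ε1 : R →ₐ[k] k) (h0 : ε0 v = 0)
    (h1 : ε1 v = 1) (x : g) (hx : IsNilpotent (ad k g x)) (e : g ≃ₗ[k] g)
    (he : (e : g →ₗ[k] g) = ∑ i ∈ Finset.range (Module.finrank k g + 1),
      (i.factorial : k)⁻¹ • (ad k g x) ^ i) :
    ∃ F : (R ⊗[k] g) ≃ₗ⁅R⁆ (R ⊗[k] g), (∀ m, specm g ε0 (F m) = specm g ε0 m) ∧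
      ∀ m, specm g ε1 (F m) = e (specm g ε1 m) := by
  let _ : Algebra ℚ R := ((algebraMap k R).comp (algebraMap ℚ k)).toAlgebra
  set X : R ⊗[k] g := (1 : R) ⊗ₜ[k] x
  have hbc : LieAlgebra.ad R (R ⊗[k] g) X = (ad k g x).baseChange R :=
    LieModule.toEnd_baseChange _ _ _ _ x
  have hz : (LieAlgebra.ad R (R ⊗[k] g) X) ^ (finrank k g + 1) = 0 := by
    rw [hbc, ← LinearMap.baseChange_pow, pow_succ (ad k g x), pow_finrank_zero _ hx]; simp
  obtain ⟨F, hF⟩ := exp_abs v X _ hz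
  have hpw : ∀ (ε : R →ₐ[k] k) i m, specm g ε ((LieAlgebra.ad R (R ⊗[k] g) X ^ i) m) =
      (ad k g x ^ i) (specm g ε m) := by
    intro ε i
    induction i with
    | zero => simp
    | succ i ih => intro m; rw [pow_succ, pow_succ, Module.End.mul_apply, Module.End.mul_apply, ih,
        ad_apply, specm_lie, ad_apply]
  have hq : ∀ (q : ℚ), algebraMap ℚ R q = (algebraMap k R (algebraMap ℚ k q)) := fun q => rfl
  have key : ∀ (ε : R →ₐ[k] k) m, specm g ε (F m) =
      ∑ i ∈ Finset.range (Module.finrank k g + 1), (i.factorial : k)⁻¹ • ((ε v) ^ i •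
        ((ad k g x) ^ i) (specm g ε m)) := by
    intro ε m
    rw [hF, map_sum]
    refine Finset.sum_congr rfl fun i _ => ?_
    rw [hq, specm_smul, specm_smul, hpw]
    simp
  refine ⟨F, fun m => ?_, fun m => ?_⟩
  · rw [key, h0, Finset.sum_range_succ']; simp
  · rw [key, h1]
    have := congrArg (fun f => f (specm g ε1 m)) he
    simp only [LinearEquiv.coe_coe] at this
    rw [this]; simp [LinearMap.sum_apply]

theorem inner_path [CharZero k] [FiniteDimensional k g] (v : R) (ε0 ε1 : R →ₐ[k] k) (h0 : ε0 v = 0)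
    (h1 : ε1 v = 1) (e : g ≃ₗ[k] g)
    (he : e ∈ Subgroup.closure {e : g ≃ₗ[k] g | ∃ x : g, IsNilpotent (ad k g x) ∧
      (e : g →ₗ[k] g) = ∑ i ∈ Finset.range (Module.finrank k g + 1),
      (i.factorial : k)⁻¹ • (ad k g x) ^ i}) :
    ∃ F : (R ⊗[k] g) ≃ₗ⁅R⁆ (R ⊗[k] g), (∀ m, specm g ε0 (F m) = specm g ε0 m) ∧
      ∀ m, specm g ε1 (F m) = e (specm g ε1 m) := by
  induction he using Subgroup.closure_induction with
  | mem e h => obtain ⟨x, hx, he⟩ := h; exact exp_path v ε0 ε1 h0 h1 x hx e he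
  | one => exact ⟨LieEquiv.refl, fun m => rfl, fun m => rfl⟩
  | mul e e' _ _ h h' =>
    obtain ⟨F, hF, hF1⟩ := h
    obtain ⟨F', hF', hF1'⟩ := h'
    refine ⟨F'.trans F, fun m => ?_, fun m => ?_⟩
    · rw [LieEquiv.trans_apply, hF, hF']
    · rw [LieEquiv.trans_apply, hF1, hF1']; rfl
  | inv e _ h =>
    obtain ⟨F, hF, hF1⟩ := h
    refine ⟨F.symm, fun m => ?_, fun m => ?_⟩
    · rw [← hF (F.symm m), LieEquiv.apply_symm_apply]
    · have := hF1 (F.symm m)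
      rw [LieEquiv.apply_symm_apply] at this
      rw [this]
      exact (e.symm_apply_apply _).symm
end spec

theorem lie_of_basis {R L ι : Type*} [CommRing R] [LieRing L] [LieAlgebra R L] (b : Basis ι R L)
    (f : L →ₗ[R] L) (h : ∀ i j, f ⁅b i, b j⁆ = ⁅f (b i), f (b j)⁆) (x y : L) :
    f ⁅x, y⁆ = ⁅f x, f y⁆ := by
  have hx : x ∈ Submodule.span R (Set.range b) := by rw [b.span_eq]; trivial
  have hy : y ∈ Submodule.span R (Set.range b) := by rw [b.span_eq]; trivial
  induction hx using Submodule.span_induction with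
  | zero => simp
  | add x x' _ _ h h' => simp only [add_lie, map_add, h, h']
  | smul c x _ h => simp only [smul_lie, map_smul, h]
  | mem x hx =>
    obtain ⟨i, rfl⟩ := hx
    induction hy using Submodule.span_induction with
    | zero => simp
    | add x x' _ _ h h' => simp only [lie_add, map_add, h, h']
    | smul c x _ h => simp only [lie_smul, map_smul, h]
    | mem x hx => obtain ⟨j, rfl⟩ := hx; exact h i j

theorem grad_aut {R L ι : Type*} [CommRing R] [LieRing L] [LieAlgebra R L] [Fintype ι]
    (b : Basis ι R L) (deg : ι → ℤ)
    (hdeg : ∀ i j l, b.repr ⁅b i, b j⁆ l ≠ 0 → deg l = deg i + deg j) (p : Rˣ) :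
    ∃ F : L ≃ₗ⁅R⁆ L, ∀ i, F (b i) = ((p ^ deg i : Rˣ) : R) • b i := by
  let e : L ≃ₗ[R] L := b.equiv (b.unitsSMul fun i => p ^ deg i) (Equiv.refl _)
  have he : ∀ i, e (b i) = ((p ^ deg i : Rˣ) : R) • b i := by
    intro i; simp [e, Basis.unitsSMul_apply, Units.smul_def]
  have hl : ∀ x y, e ⁅x, y⁆ = ⁅e x, e y⁆ := by
    refine lie_of_basis b (e : L →ₗ[R] L) fun i j => ?_
    simp only [LinearEquiv.coe_coe, he, smul_lie, lie_smul, smul_smul]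
    rw [← b.sum_repr ⁅b i, b j⁆, map_sum, Finset.smul_sum]
    refine Finset.sum_congr rfl fun l _ => ?_
    rw [map_smul, he, smul_comm]
    by_cases h : b.repr ⁅b i, b j⁆ l = 0
    · rw [h]; simp
    · rw [hdeg i j l h, zpow_add, Units.val_mul, mul_comm]
  exact ⟨{ e with map_lie' := fun {x y} => hl x y }, he⟩

open TensorProduct in
theorem grad_bc {k R g ι : Type*} [Field k] [CommRing R] [Algebra k R] [LieRing g] [LieAlgebra k g]
    [Fintype ι] (b : Basis ι k g) (deg : ι → ℤ)
    (hdeg : ∀ i j l, b.repr ⁅b i, b j⁆ l ≠ 0 → deg l = deg i + deg j) (i j l : ι)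
    (h : (b.baseChange R).repr ⁅b.baseChange R i, b.baseChange R j⁆ l ≠ 0) :
    deg l = deg i + deg j := by
  apply hdeg
  intro h0
  apply h
  simp [Basis.baseChange_apply, Basis.baseChange_repr_tmul, h0]

theorem eps_zpow {k R : Type*} [Field k] [CommRing R] [Algebra k R] (ε : R →ₐ[k] k) (q : Rˣ) (n : ℤ) :
    ε ((q ^ n : Rˣ) : R) = (ε q) ^ n := by
  have h1 : ((Units.map (ε : R →* k) (q ^ n) : kˣ) : k) = ((Units.map (ε : R →* k) q) ^ n : kˣ) := by
    rw [map_zpow]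
  rw [Units.val_zpow_eq_zpow_val] at h1
  exact h1

open TensorProduct in
theorem sp_one {k R g ι : Type*} [Field k] [CommRing R] [Algebra k R] [LieRing g] [LieAlgebra k g]
    [Fintype ι] (b : Basis ι k g) (d : ι → ℤ) (ε : R →ₐ[k] k) (q : Rˣ)
    (Λ : (R ⊗[k] g) ≃ₗ⁅R⁆ (R ⊗[k] g))
    (hΛ : ∀ i, Λ (b.baseChange R i) = ((q ^ d i : Rˣ) : R) • b.baseChange R i) (hq : ε q = 1)
    (m : R ⊗[k] g) : specm g ε (Λ m) = specm g ε m := by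
  have hm : m ∈ Submodule.span R (Set.range (b.baseChange R)) := by rw [Basis.span_eq]; trivial
  induction hm using Submodule.span_induction with
  | zero => congr 1; exact Λ.toLinearEquiv.map_zero
  | add x y _ _ h h' =>
    have : Λ (x + y) = Λ x + Λ y := Λ.toLinearEquiv.map_add _ _
    rw [this, map_add, map_add, h, h']
  | smul r x _ h =>
    have : Λ (r • x) = r • Λ x := Λ.toLinearEquiv.map_smul _ _
    rw [this, specm_smul, specm_smul, h]
  | mem x h =>
    obtain ⟨i, rfl⟩ := h
    rw [hΛ, specm_smul, eps_zpow, hq]; simp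

open Polynomial TensorProduct in
theorem path_bound {k g I J κ : Type*} [Field k] [CharZero k] [LieRing g] [LieAlgebra k g]
    [FiniteDimensional k g]
    [Fintype I] [Fintype J] [Fintype κ] [DecidableEq I] [DecidableEq κ] [DecidableEq k]
    (b : Basis (I ⊕ J) k g) (a : I → J → k)
    (hHH : ∀ i i', ⁅b (.inl i), b (.inl i')⁆ = 0)
    (hHJ : ∀ i j, ⁅b (.inl i), b (.inr j)⁆ = a i j • b (.inr j))
    (Y : I → k) (hY : ∀ j, ∑ i, Y i * a i j ≠ 0)
    (B : J → I → k) (hB : ∀ i i', ∑ j, a i j * B j i' = if i = i' then 1 else 0)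
    (dy : I ⊕ J → ℤ) (hdy : ∀ i j l, b.repr ⁅b i, b j⁆ l ≠ 0 → dy l = dy i + dy j)
    (hdy0 : ∀ i, dy (.inl i) = 0)
    (c : Basis κ k g) (dz : κ → ℤ) (hdz : ∀ i j l, c.repr ⁅c i, c j⁆ l ≠ 0 → dz l = dz i + dz j)
    (μ : g ≃ₗ⁅k⁆ g) (mm : κ → k) (hmm : ∀ i, μ (c i) = mm i • c i)
    (hμ : μ.toLinearEquiv ∈ Subgroup.closure {e : g ≃ₗ[k] g | ∃ x : g, IsNilpotent (ad k g x) ∧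
      (e : g →ₗ[k] g) = ∑ i ∈ Finset.range (Module.finrank k g + 1),
      (i.factorial : k)⁻¹ • (ad k g x) ^ i})
    (u : k) (hu : u ≠ 0) (huy : ∀ j, u ^ dy (.inr j) ≠ 1) :
    Fintype.card I ≤ (Finset.univ.filter fun i => mm i * u ^ dz i = 1).card := by
  obtain ⟨R, _, _, _, _, v, ε0, ε1, q1, q2, h0, h1, h01, h11, h02, h12, hker⟩ :=
    exists_path_ring u hu
  let _ : Algebra ℚ R := ((algebraMap k R).comp (algebraMap ℚ k)).toAlgebra
  obtain ⟨F, hF0, hF1⟩ := inner_path v ε0 ε1 h0 h1 μ.toLinearEquiv hμ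
  obtain ⟨Ly, hLy⟩ := grad_aut (b.baseChange R) dy (grad_bc b dy hdy) q2
  obtain ⟨Lz, hLz⟩ := grad_aut (c.baseChange R) dz (grad_bc c dz hdz) q1
  set Φ : (R ⊗[k] g) ≃ₗ⁅R⁆ (R ⊗[k] g) := (Ly.trans Lz).trans F with hΦ
  have hvu : ¬ IsUnit v := by
    intro h; have := h.map ε0; rw [h0] at this; simp at this
  have hsm : ∀ (r : k) (x : g), (1 : R) ⊗ₜ[k] (r • x) = (algebraMap k R r) • ((1 : R) ⊗ₜ[k] x) := by
    intro r x
    rw [TensorProduct.tmul_smul, algebraMap_smul]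
  have hΦ0 : ∀ m, specm g ε0 (Φ m) = specm g ε0 (Ly m) := by
    intro m
    rw [hΦ, LieEquiv.trans_apply, LieEquiv.trans_apply, hF0, sp_one c dz ε0 q1 Lz hLz h01]
  have hun : ∀ r : k, r ≠ 0 → IsUnit (algebraMap k R r) := fun r hr => (IsUnit.mk0 r hr).map _
  have hdvd : (X - 1 : R[X]) ^ Fintype.card I ∣
      (Φ.toLinearEquiv : (R ⊗[k] g) →ₗ[R] (R ⊗[k] g)).charpoly := by
    refine core_domain (b.baseChange R) (fun i j => algebraMap k R (a i j)) ?_ ?_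
      (fun i => algebraMap k R (Y i)) ?_ (fun i j => algebraMap k R (B i j)) ?_
      (fun j => algebraMap k R (u ^ dy (.inr j))) (fun j => hun _ (zpow_ne_zero _ hu)) ?_ v hvu
      Φ ?_ ?_
    · intro i i'; simp [Basis.baseChange_apply, hHH]
    · intro i j; simp only [Basis.baseChange_apply, ExtendScalars.bracket_tmul, hHJ, mul_one, hsm]
    · intro j; have := hun _ (hY j); simpa using this
    · intro i i'; have := congrArg (algebraMap k R) (hB i i')
      simpa [apply_ite (algebraMap k R)] using this
    · intro j; have := hun _ (sub_ne_zero.2 (huy j)); simpa using this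
    · intro i
      refine specm_zero_mem ε0 v hker b _ ?_
      rw [map_sub, hΦ0, hLy, specm_smul, hdy0]
      simp
    · intro j
      refine specm_zero_mem ε0 v hker b _ ?_
      rw [map_sub, hΦ0, hLy, specm_smul, specm_smul, eps_zpow, h02]
      simp
  have h1Φ : ∀ j, specm g ε1 (Φ (c.baseChange R j)) = (mm j * u ^ dz j) • c j := by
    intro j
    have e1 : ∀ m, specm g ε1 (Φ m) = μ (specm g ε1 (Lz (Ly m))) := fun m => hF1 _
    have e2 : ∀ m m' : R ⊗[k] g, specm g ε1 m = specm g ε1 m' →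
        specm g ε1 (Lz m) = specm g ε1 (Lz m') := by
      intro m m' h
      have h' : specm g ε1 (m - m') = 0 := by rw [map_sub, h, sub_self]
      have h3 : ∀ m, specm g ε1 (Lz m) = ∑ i, (u ^ dz i * c.repr (specm g ε1 m) i) • c i := by
        intro m
        conv_lhs => rw [← (c.baseChange R).sum_repr m]
        have : Lz (∑ i, (c.baseChange R).repr m i • (c.baseChange R) i) =
          ∑ i, (c.baseChange R).repr m i • Lz ((c.baseChange R) i) := by
          have := map_sum Lz.toLinearEquiv (fun i => (c.baseChange R).repr m i • (c.baseChange R) i) Finset.univ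
          simp only [map_smul] at this
          exact this
        rw [this, map_sum]
        refine Finset.sum_congr rfl fun i _ => ?_
        rw [specm_smul, hLz, specm_smul, eps_zpow, h11, ← specm_repr]
        simp [smul_smul, mul_comm]
      rw [h3, h3, h]
    rw [e1, e2 _ _ (sp_one b dy ε1 q2 Ly hLy h12 _), hLz, specm_smul, eps_zpow, h11]
    have : μ (u ^ dz j • c j) = u ^ dz j • μ (c j) := μ.toLinearEquiv.map_smul _ _
    simp [this, hmm, smul_smul, mul_comm]
  have hcp : ((Φ.toLinearEquiv : (R ⊗[k] g) →ₗ[R] (R ⊗[k] g)).charpoly).map (ε1 : R →+* k) =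
      ∏ j, (X - C (mm j * u ^ dz j)) := by
    rw [← LinearMap.charpoly_toMatrix _ (c.baseChange R), ← Matrix.charpoly_map]
    have : (LinearMap.toMatrix (c.baseChange R) (c.baseChange R)
      (Φ.toLinearEquiv : (R ⊗[k] g) →ₗ[R] (R ⊗[k] g))).map (ε1 : R →+* k) =
        Matrix.diagonal fun j => mm j * u ^ dz j := by
      ext i j
      rw [Matrix.map_apply, LinearMap.toMatrix_apply]
      have h2 := specm_repr ε1 c (Φ (c.baseChange R j)) i
      rw [h1Φ] at h2
      refine h2.symm.trans ?_
      simp [Matrix.diagonal_apply, Finsupp.single_apply]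
      by_cases h : i = j
      · subst h; simp
      · simp [h, Ne.symm h]
    rw [this, Matrix.charpoly_diagonal]
  have hd2 := Polynomial.map_dvd (ε1 : R →+* k) hdvd
  rw [hcp] at hd2
  simp only [Polynomial.map_pow, Polynomial.map_sub, Polynomial.map_X, Polynomial.map_one] at hd2
  have hne : (∏ j, (X - C (mm j * u ^ dz j))) ≠ 0 :=
    Finset.prod_ne_zero_iff.2 fun j _ => X_sub_C_ne_zero _
  have hrm := (le_rootMultiplicity_iff (a := (1 : k)) (n := Fintype.card I) hne).2 (by simpa using hd2)
  refine hrm.trans ?_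
  rw [← count_roots, roots_prod _ _ hne]
  simp only [roots_X_sub_C, Multiset.bind_singleton]
  rw [Multiset.count_map]
  simp only [eq_comm (a := (1 : k))]
  exact le_of_eq rfl

theorem exists_int_deg {k κ : Type*} [Field k] [CharZero k] [Finite κ] (s : κ → k) :
    ∃ d : κ → ℤ, (∀ i j l, s l = s i + s j → d l = d i + d j) ∧ ∀ i, d i = 0 ↔ s i = 0 := by
  classical
  obtain ⟨f, hf⟩ := Module.exists_dual_forall_apply_ne_zero (K := ℚ) (M := k)
    (fun i : {i // s i ≠ 0} => s i) (fun i => i.2)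
  cases nonempty_fintype κ
  obtain ⟨b, hb⟩ := IsLocalization.exist_integer_multiples (nonZeroDivisors ℤ) (S := ℚ)
    (Finset.univ : Finset κ) (fun i => f (s i))
  have hb0 : ((b : ℤ) : ℚ) ≠ 0 := by exact_mod_cast nonZeroDivisors.coe_ne_zero b
  choose d hd using fun i => hb i (Finset.mem_univ i)
  have hd' : ∀ i, (d i : ℚ) = (b : ℤ) * f (s i) := by
    intro i; have := hd i; simpa [zsmul_eq_mul, Submonoid.smul_def] using this
  refine ⟨d, fun i j l h => ?_, fun i => ⟨fun h => ?_, fun h => ?_⟩⟩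
  · have : (d l : ℚ) = d i + d j := by rw [hd', hd', hd', h, map_add, mul_add]
    exact_mod_cast this
  · by_contra h0
    have h1 := hd' i
    rw [h] at h1
    have := hf ⟨i, h0⟩
    simp_all
  · have h1 := hd' i
    rw [h] at h1; simpa using h1

theorem exists_grading {k g κ : Type*} [Field k] [CharZero k] [LieRing g] [LieAlgebra k g]
    [Fintype κ] (c : Basis κ k g) (z : g) (s : κ → k) (hs : ∀ i, ⁅z, c i⁆ = s i • c i) :
    ∃ d : κ → ℤ, (∀ i j l, c.repr ⁅c i, c j⁆ l ≠ 0 → d l = d i + d j) ∧ ∀ i, d i = 0 ↔ s i = 0 := by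
  obtain ⟨d, h1, h2⟩ := exists_int_deg s
  refine ⟨d, fun i j l h => h1 i j l ?_, h2⟩
  have e1 : ⁅z, ⁅c i, c j⁆⁆ = (s i + s j) • ⁅c i, c j⁆ := by
    rw [leibniz_lie, hs, hs, smul_lie, lie_smul, add_smul]
  have e2 : ∀ w : g, c.repr ⁅z, w⁆ l = s l * c.repr w l := by
    intro w
    conv_lhs => rw [← c.sum_repr w]
    simp only [lie_sum, lie_smul, hs, map_sum, map_smul, Basis.repr_self]
    classical
    rw [Finsupp.finsetSum_apply, Finset.sum_eq_single l]
    · simp [mul_comm]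
    · intro i _ hi; simp [Finsupp.single_apply, hi]
    · simp
  have e3 := e2 ⁅c i, c j⁆
  rw [e1, map_smul] at e3
  exact (mul_right_cancel₀ h e3).symm

theorem exists_basis_of_span {k g : Type*} [Field k] [AddCommGroup g] [Module k g] (S : Set g)
    (hS : (⊤ : Submodule k g) ≤ Submodule.span k S) :
    ∃ (β : Set g) (b : Basis β k g), (∀ i, b i = i) ∧ ∀ i : β, (i : g) ∈ S := by
  refine ⟨_, Basis.ofSpan hS, Basis.ofSpan_apply_self hS, fun i => ?_⟩
  have := Basis.ofSpan_subset hS ⟨i, rfl⟩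
  rwa [Basis.ofSpan_apply_self hS] at this

theorem cartan_basis {k g : Type*} [Field k] [IsAlgClosed k] [CharZero k] [LieRing g]
    [LieAlgebra k g] [FiniteDimensional k g] [LieAlgebra.IsKilling k g]
    (H : LieSubalgebra k g) [H.IsCartanSubalgebra] :
    ∃ (β : Set g) (b : Basis β k g) (y : g) (α : β → g → k), (∀ i, b i = i) ∧ y ∈ H ∧
      (∀ i : β, (i : g) ∉ H → α i y ≠ 0) ∧ (∀ i : β, (i : g) ∉ H → ∀ h ∈ H, ⁅h, b i⁆ = α i h • b i) := by
  classical
  obtain ⟨y, hy⟩ := Module.Dual.exists_forall_ne_zero_of_forall_exists (K := k) (M := H)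
    (fun α : H.root => (LieModule.Weight.toLinear k H g α)) (by
      intro α
      have hα := LieSubalgebra.isNonZero_coe_root α
      by_contra! h
      exact hα (by
        rw [LieModule.Weight.IsZero]
        ext x; exact h x))
  let S : Set g := (H : Set g) ∪ {x | ∃ α : H.root, x ∈ rootSpace H (α : LieModule.Weight k H g)}
  have hS : (⊤ : Submodule k g) ≤ Submodule.span k S := by
    have := LieModule.iSup_genWeightSpace_eq_top' k H g
    have h2 : (⨆ χ : LieModule.Weight k H g, (LieModule.genWeightSpace g χ).toSubmodule) = ⊤ := by
      rw [← LieSubmodule.iSup_toSubmodule, this]; rfl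
    rw [← h2]
    refine iSup_le fun χ => fun x hx => Submodule.subset_span ?_
    by_cases h : χ.IsZero
    · left
      have h3 : x ∈ rootSpace H (0 : H → k) := by
        have := h.eq
        rw [← this]
        exact hx
      rw [rootSpace_zero_eq] at h3
      exact h3
    · right
      exact ⟨⟨χ, by simpa [LieSubalgebra.root] using h⟩, hx⟩
  obtain ⟨β, b, hb, hmem⟩ := exists_basis_of_span S hS
  have hex : ∀ i : β, ∃ α : g → k, (i : g) ∉ H → α y ≠ 0 ∧ ∀ h ∈ H, ⁅h, b i⁆ = α h • b i := by
    intro i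
    rcases hmem i with h | ⟨α, h⟩
    · exact ⟨0, fun h' => absurd (h) h'⟩
    · refine ⟨fun x => if hx : x ∈ H then (α : LieModule.Weight k H g) ⟨x, hx⟩ else 0, fun _ => ⟨?_, fun x hx => ?_⟩⟩
      · simpa using hy α
      · simp only [hx, dite_true]
        exact IsKilling.lie_eq_smul_of_mem_rootSpace (hb i ▸ h) ⟨x, hx⟩
  choose α hα using hex
  exact ⟨_, b, y, α, hb, y.2, fun i hi => (hα i hi).1, fun i hi => (hα i hi).2⟩

theorem exists_avoid {k ι : Type*} [Field k] [CharZero k] [Finite ι] (n : ι → ℤ) (m : ι → k)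
    (hn : ∀ i, n i ≠ 0) : ∃ u : k, u ≠ 0 ∧ ∀ i, m i * u ^ n i ≠ 1 := by
  classical
  cases nonempty_fintype ι
  have : Infinite k := CharZero.infinite k
  obtain ⟨u, hu⟩ := Infinite.exists_notMem_finset (insert (0 : k) (Finset.univ.biUnion fun i : ι =>
    (Polynomial.nthRoots (n i).natAbs (m i)⁻¹).toFinset ∪
    (Polynomial.nthRoots (n i).natAbs (m i)).toFinset))
  simp only [Finset.mem_insert, Finset.mem_biUnion, Finset.mem_univ, true_and, Finset.mem_union,
    Multiset.mem_toFinset, not_or, not_exists] at hu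
  refine ⟨u, hu.1, fun i h => ?_⟩
  obtain ⟨h1, h2⟩ := hu.2 i
  have hp : 0 < (n i).natAbs := Int.natAbs_pos.2 (hn i)
  rw [Polynomial.mem_nthRoots hp] at h1 h2
  rcases Int.natAbs_eq (n i) with h3 | h3
  · rw [h3, zpow_natCast] at h
    exact h1 (eq_inv_of_mul_eq_one_right h)
  · rw [h3, zpow_neg, zpow_natCast] at h
    exact h2 (by
      have : u ^ (n i).natAbs ≠ 0 := pow_ne_zero _ hu.1
      field_simp at h; exact h.symm)

theorem right_inv_of_inj {k I J : Type*} [Field k] [Fintype I] [Fintype J] [DecidableEq I]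
    (a : I → J → k) (h : ∀ x : I → k, (∀ j, ∑ i, x i * a i j = 0) → x = 0) :
    ∃ B : J → I → k, ∀ i i', ∑ j, a i j * B j i' = if i = i' then 1 else 0 := by
  classical
  let f : (I → k) →ₗ[k] (J → k) := Matrix.vecMulLinear (Matrix.of a)
  have hf : LinearMap.ker f = ⊥ := by
    rw [LinearMap.ker_eq_bot']
    intro x hx
    refine h x fun j => ?_
    exact congrFun hx j
  obtain ⟨G, hG⟩ := f.exists_leftInverse_of_injective hf
  refine ⟨fun j i' => G (Pi.single j 1) i', fun i i' => ?_⟩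
  have h1 := LinearMap.congr_fun hG (Pi.single i 1)
  have h2 : f (Pi.single i 1) = ∑ j, a i j • Pi.single j (1 : k) := by
    ext j
    simp [f, Pi.single_apply]
  rw [LinearMap.comp_apply, h2, map_sum] at h1
  have h3 := congrFun h1 i'
  simp only [map_smul, Finset.sum_apply, Pi.smul_apply, smul_eq_mul, LinearMap.id_apply] at h3
  rw [h3, Pi.single_apply]
  simp [eq_comm]

theorem rank_bound {k g : Type*} [Field k] [IsAlgClosed k] [CharZero k] [LieRing g]
    [LieAlgebra k g] [FiniteDimensional k g] [LieAlgebra.IsKilling k g]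
    (H : LieSubalgebra k g) [H.IsCartanSubalgebra]
    {κ : Type*} [Fintype κ] (c : Basis κ k g) (μ : g ≃ₗ⁅k⁆ g) (mm : κ → k)
    (hmm : ∀ i, μ (c i) = mm i • c i)
    (z : g) (s : κ → k) (hs : ∀ i, ⁅z, c i⁆ = s i • c i)
    (hμ : μ.toLinearEquiv ∈ Subgroup.closure {e : g ≃ₗ[k] g | ∃ x : g, IsNilpotent (ad k g x) ∧
      (e : g →ₗ[k] g) = ∑ i ∈ Finset.range (Module.finrank k g + 1),
      (i.factorial : k)⁻¹ • (ad k g x) ^ i})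
    (t : Submodule k g) (ht : ∀ x, μ x = x → ⁅z, x⁆ = 0 → x ∈ t) :
    finrank k H ≤ finrank k t := by
  classical
  obtain ⟨β, b, y, α, hb, hyH, hαy, hα⟩ := cartan_basis H
  have : Fintype β := FiniteDimensional.fintypeBasisIndex b
  let I := {i : β // (i : g) ∈ H}
  let J := {i : β // (i : g) ∉ H}
  let b' : Basis (I ⊕ J) k g := b.reindex (Equiv.sumCompl fun i : β => (i : g) ∈ H).symm
  have hbI : ∀ i : I, b' (.inl i) = (i : β) := by intro i; rw [Basis.reindex_apply, Equiv.symm_symm, hb]; rfl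
  have hbJ : ∀ i : J, b' (.inr i) = b (i : β) := by intro i; rw [Basis.reindex_apply, Equiv.symm_symm]; rfl
  have hab : ∀ x ∈ H, ∀ y ∈ H, ⁅x, y⁆ = 0 := by
    intro x hx y hy
    have := congrArg Subtype.val (trivial_lie_zero H H ⟨x, hx⟩ ⟨y, hy⟩)
    exact this
  have hy0 : ∀ i : I, ⁅y, b' (.inl i)⁆ = 0 := fun i => hab _ hyH _ (by rw [hbI]; exact i.2)
  have hyJ : ∀ j : J, ⁅y, b' (.inr j)⁆ = α j y • b' (.inr j) := by
    intro j; rw [hbJ]; exact hα _ j.2 _ hyH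
  have hcoord : ∀ h ∈ H, ∀ j, b'.repr h (.inr j) = 0 := by
    intro h hh j
    have h0 : ⁅y, h⁆ = 0 := hab _ hyH _ hh
    rw [← b'.sum_repr h, Fintype.sum_sum_type, lie_add, lie_sum, lie_sum] at h0
    simp only [lie_smul, hy0, smul_zero, Finset.sum_const_zero, zero_add, hyJ, smul_smul] at h0
    have h1 := congrArg (fun w => b'.repr w (.inr j)) h0
    simp only [map_sum, map_smul, Basis.repr_self, Finsupp.finsetSum_apply] at h1
    rw [Finset.sum_eq_single j] at h1
    · simpa [hαy j j.2] using h1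
    · intro i _ hi; simp [Finsupp.single_apply, hi]
    · simp
  have hsum : ∀ h ∈ H, h = ∑ i : I, b'.repr h (.inl i) • b' (.inl i) := by
    intro h hh
    conv_lhs => rw [← b'.sum_repr h]
    rw [Fintype.sum_sum_type]
    simp [hcoord h hh]
  have hcard : finrank k H ≤ Fintype.card I := by
    have h1 : H.toSubmodule ≤ Submodule.span k (Set.range fun i : I => b' (.inl i)) := by
      intro h hh
      rw [hsum h hh]
      exact Submodule.sum_mem _ fun i _ => Submodule.smul_mem _ _ (Submodule.subset_span ⟨i, rfl⟩)
    exact (Submodule.finrank_mono h1).trans (finrank_range_le_card _)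
  refine hcard.trans ?_
  have hαlin : ∀ (j : J) (x : I → k), α j (∑ i, x i • b' (.inl i)) = ∑ i, x i * α j (b' (.inl i)) := by
    intro j x
    have hm : (∑ i, x i • b' (.inl i)) ∈ H :=
      Submodule.sum_mem H.toSubmodule fun i _ => H.smul_mem _ (by rw [hbI]; exact i.2)
    have h1 := hα j j.2 _ hm
    rw [sum_lie] at h1
    have h2 : ∀ i : I, ⁅x i • b' (.inl i), b (j : β)⁆ = (x i * α j (b' (.inl i))) • b (j : β) := by
      intro i
      rw [smul_lie, hα j j.2 _ (by rw [hbI]; exact i.2), smul_smul]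
    simp only [h2, ← Finset.sum_smul] at h1
    exact (smul_left_injective k (b.ne_zero (j : β)) h1).symm
  obtain ⟨B, hB⟩ := right_inv_of_inj (fun (i : I) (j : J) => α j (b' (.inl i))) (by
    intro x hx
    have hm : (∑ i, x i • b' (.inl i)) ∈ H :=
      Submodule.sum_mem H.toSubmodule fun i _ => H.smul_mem _ (by rw [hbI]; exact i.2)
    have hc : ∀ w : g, ⁅∑ i, x i • b' (.inl i), w⁆ = 0 := by
      intro w
      rw [← b'.sum_repr w, lie_sum, Fintype.sum_sum_type]
      have e1 : ∀ i : I, ⁅∑ i, x i • b' (.inl i), b'.repr w (.inl i) • b' (.inl i)⁆ = 0 := by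
        intro i; rw [lie_smul, hab _ hm _ (by rw [hbI]; exact i.2), smul_zero]
      have e2 : ∀ i : J, ⁅∑ i, x i • b' (.inl i), b'.repr w (.inr i) • b' (.inr i)⁆ = 0 := by
        intro j; rw [lie_smul, hbJ, hα j j.2 _ hm, hαlin, hx j, zero_smul, smul_zero]
      simp only [e1, e2, Finset.sum_const_zero, add_zero]
    have h0 : (∑ i, x i • b' (.inl i)) = 0 := by
      have h1 : (∑ i, x i • b' (.inl i)) ∈ LieAlgebra.center k g := by
        rw [LieModule.mem_maxTrivSubmodule]
        intro w; rw [← lie_skew, hc, neg_zero]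
      rw [LieAlgebra.center_eq_bot] at h1
      exact h1
    have hli : LinearIndependent k fun i : I => b' (.inl i) :=
      b'.linearIndependent.comp _ Sum.inl_injective
    ext i
    exact (Fintype.linearIndependent_iff.1 hli) x h0 i)
  obtain ⟨dy, hdy, hdy0⟩ := exists_grading b' y (Sum.elim (fun _ => 0) fun j => α j y) (by
    rintro (i | j)
    · simp [hy0]
    · simp [hyJ])
  obtain ⟨dz, hdz, hdz0⟩ := exists_grading c z s hs
  obtain ⟨u, hu, hav⟩ := exists_avoid (k := k) (ι := J ⊕ {i : κ // dz i ≠ 0})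
    (Sum.elim (fun j => dy (.inr j)) fun i => dz i) (Sum.elim (fun _ => 1) fun i => mm i) (by
      rintro (j | i)
      · simp only [Sum.elim_inl, ne_eq, hdy0]
        simpa using hαy j j.2
      · exact i.2)
  have key := path_bound b' (fun (i : I) (j : J) => α j (b' (.inl i))) (fun i i' =>
    hab _ (by rw [hbI]; exact i.2) _ (by rw [hbI]; exact i'.2))
    (fun i j => by rw [hbJ]; exact hα j j.2 _ (by rw [hbI]; exact i.2))
    (fun i => b'.repr y (.inl i)) (fun j => by
      have := hαy j j.2
      rw [hsum y hyH, hαlin] at this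
      exact this) B hB dy hdy (fun i => by rw [hdy0]; rfl) c dz hdz μ mm hmm hμ u hu
      (fun j => by simpa using hav (.inl j))
  refine key.trans ?_
  rw [← Fintype.card_coe]
  let T := (Finset.univ.filter fun i => mm i * u ^ dz i = 1)
  have hT : ∀ i : T, c i ∈ t := by
    rintro ⟨i, hi⟩
    have h1 : mm i * u ^ dz i = 1 := by simpa [T] using hi
    have h2 : dz i = 0 := by
      by_contra h; exact hav (.inr ⟨i, h⟩) h1
    refine ht _ ?_ ?_
    · rw [h2, zpow_zero, mul_one] at h1; rw [hmm, h1, one_smul]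
    · rw [hs, (hdz0 i).1 h2, zero_smul]
  have hli : LinearIndependent k fun i : T => (⟨c i, hT i⟩ : t) := by
    apply LinearIndependent.of_comp t.subtype
    exact c.linearIndependent.comp _ Subtype.val_injective
  exact hli.fintype_card_le_finrank

theorem eq_zero_of_central {k g : Type*} [Field k] [LieRing g] [LieAlgebra k g]
    [FiniteDimensional k g] [LieAlgebra.IsKilling k g] (x : g) (h : ∀ w : g, ⁅x, w⁆ = 0) : x = 0 := by
  have h1 : x ∈ LieAlgebra.center k g := by
    rw [LieModule.mem_maxTrivSubmodule]
    intro w; rw [← lie_skew, h, neg_zero]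
  rw [LieAlgebra.center_eq_bot] at h1
  exact h1

theorem exists_engel {k g : Type*} [Field k] [CharZero k] [LieRing g] [LieAlgebra k g]
    [FiniteDimensional k g] (C : LieSubalgebra k g) :
    ∃ x ∈ C, ∃ H : LieSubalgebra k g, (∀ w, w ∈ H ↔ w ∈ C ∧ ∃ n : ℕ, ((ad k g x) ^ n) w = 0) ∧
      LieRing.IsNilpotent H ∧ ∀ w ∈ C, (∀ h ∈ H, ⁅w, h⁆ ∈ H) → w ∈ H := by
  have : Infinite k := CharZero.infinite k
  obtain ⟨x, hx⟩ := exists_isCartanSubalgebra_engel k C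
  have hmem : ∀ w : C, (w : g) ∈ (LieSubalgebra.engel k x).map C.incl ↔ w ∈ LieSubalgebra.engel k x := by
    intro w
    rw [LieSubalgebra.mem_map]
    constructor
    · rintro ⟨y, hy, h⟩
      have : y = w := Subtype.ext h
      exact this ▸ hy
    · intro h; exact ⟨w, h, rfl⟩
  have hpow : ∀ (n : ℕ) (w : C), (((ad k C x) ^ n) w : C) = ((ad k g x) ^ n) (w : g) := by
    intro n
    induction n with
    | zero => intro w; simp
    | succ n ih => intro w; rw [pow_succ, pow_succ, Module.End.mul_apply, Module.End.mul_apply, ih]; rfl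
  refine ⟨x, x.2, (LieSubalgebra.engel k x).map C.incl, ?_, ?_, ?_⟩
  · intro w
    constructor
    · intro h
      have hC : w ∈ C := by
        obtain ⟨y, _, rfl⟩ := (LieSubalgebra.mem_map _ _ _).1 h
        exact y.2
      refine ⟨hC, ?_⟩
      have h2 := (hmem ⟨w, hC⟩).1 h
      rw [LieSubalgebra.mem_engel_iff] at h2
      obtain ⟨n, hn⟩ := h2
      exact ⟨n, by rw [← hpow n ⟨w, hC⟩, hn]; rfl⟩
    · rintro ⟨hC, n, hn⟩
      refine (hmem ⟨w, hC⟩).2 ?_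
      rw [LieSubalgebra.mem_engel_iff]
      exact ⟨n, Subtype.ext (by rw [hpow, hn]; rfl)⟩
  · have := hx.nilpotent
    exact (LieEquiv.nilpotent_iff_equiv_nilpotent
      (LieSubalgebra.equivMapOfInjective (K := LieSubalgebra.engel k x) (f := C.incl) Subtype.val_injective)).1 this
  · intro w hw h
    refine (hmem ⟨w, hw⟩).2 ?_
    rw [← LieSubalgebra.normalizer_engel, LieSubalgebra.mem_normalizer_iff]
    intro y hy
    exact (hmem _).1 (h y ((hmem y).2 hy))

open Module.End in
theorem jordan_elt {k g : Type*} [Field k] [IsAlgClosed k] [CharZero k] [LieRing g]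
    [LieAlgebra k g] [FiniteDimensional k g] [LieAlgebra.IsKilling k g] (x : g) :
    ∃ s : g, (ad k g s).IsSemisimple ∧ IsNilpotent (ad k g (x - s)) ∧
      (∀ w : g, ⁅x, w⁆ = 0 → ⁅s, w⁆ = 0) ∧ (∀ φ : g ≃ₗ⁅k⁆ g, φ x = x → φ s = s) ∧
      ∀ w, (∃ n : ℕ, ((ad k g x) ^ n) w = 0) ↔ ⁅s, w⁆ = 0 := by
  obtain ⟨N, -, S, hSa, hN, hS, hSN⟩ := (ad k g x).exists_isNilpotent_isSemisimple
  have hS₀ : Commute (ad k g x) S := Algebra.commute_of_mem_adjoin_self hSa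
  have hN' := hN
  rw [eq_sub_of_add_eq hSN.symm] at hN
  have aux {a : k} {y : g} (hy : y ∈ (ad k g x).maxGenEigenspace a) : S y = a • y :=
    apply_eq_of_mem_of_comm_of_isFinitelySemisimple_of_isNil hy hS₀ hS.isFinitelySemisimple hN
  have h_der (y z : g) : S ⁅y, z⁆ = ⁅S y, z⁆ + ⁅y, S z⁆ := by
    have htop := Module.End.iSup_maxGenEigenspace_eq_top (ad k g x)
    have hy : y ∈ ⨆ a : k, (ad k g x).maxGenEigenspace a := by rw [htop]; trivial
    have hz : z ∈ ⨆ a : k, (ad k g x).maxGenEigenspace a := by rw [htop]; trivial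
    induction hy using Submodule.iSup_induction' with
    | mem α y hy =>
      induction hz using Submodule.iSup_induction' with
      | mem β z hz =>
        have hyz : ⁅y, z⁆ ∈ (ad k g x).maxGenEigenspace (α + β) :=
          LieModule.lie_mem_maxGenEigenspace_toEnd hy hz
        rw [aux hy, aux hz, aux hyz, smul_lie, lie_smul, ← add_smul]
      | zero => simp
      | add _ _ _ _ h h' => simp only [lie_add, map_add, h, h']; abel
    | zero => simp
    | add _ _ _ _ h h' => simp only [add_lie, map_add, h, h']; abel
  replace h_der : ∀ y z : g, S ⁅y, z⁆ = ⁅y, S z⁆ - ⁅z, S y⁆ := by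
    simp_rw [← lie_skew (S _) _, add_comm, ← sub_eq_add_neg] at h_der; assumption
  let S' : LieDerivation k g g := ⟨S, h_der⟩
  obtain ⟨s, hs⟩ := LieDerivation.IsKilling.exists_eq_ad S'
  have hSs : S = ad k g s := by rw [← LieDerivation.coe_ad_apply_eq_ad_apply s, hs]
  have hss : ∀ w, S w = ⁅s, w⁆ := fun w => by rw [hSs]; rfl
  refine ⟨s, hSs ▸ hS, by rw [map_sub, ← hSs]; exact hN, ?_, ?_, ?_⟩
  · intro w hw
    have hc : Commute (ad k g w) (ad k g x) := by
      ext v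
      change ⁅w, ⁅x, v⁆⁆ = ⁅x, ⁅w, v⁆⁆
      rw [leibniz_lie x w v, hw, zero_lie, zero_add]
    have h2 := Algebra.commute_of_mem_adjoin_singleton_of_commute hSa hc
    refine eq_zero_of_central (k := k) _ fun v => ?_
    have h3 := LinearMap.congr_fun h2 v
    rw [hSs] at h3
    have h4 : ⁅w, ⁅s, v⁆⁆ = ⁅s, ⁅w, v⁆⁆ := h3
    rw [lie_lie, h4, sub_self]
  · intro φ hφ
    have hc : Commute ((φ.toLinearEquiv : g →ₗ[k] g) : End k g) (ad k g x) := by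
      ext w
      change φ ⁅x, w⁆ = ⁅x, φ w⁆
      rw [LieEquiv.map_lie, hφ]
    have h2 := Algebra.commute_of_mem_adjoin_singleton_of_commute hSa hc
    have h3 : ∀ w, φ ⁅s, w⁆ = ⁅s, φ w⁆ := by
      intro w
      have := LinearMap.congr_fun h2 w
      rw [hSs] at this
      exact this
    rw [← sub_eq_zero]
    refine eq_zero_of_central (k := k) _ fun w => ?_
    obtain ⟨v, rfl⟩ := φ.surjective w
    change ⁅φ s - s, φ v⁆ = 0
    rw [sub_lie, ← LieEquiv.map_lie, h3, sub_self]
  · intro w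
    rw [← hss]
    constructor
    · intro h
      have := aux (a := 0) (y := w) ((Module.End.mem_maxGenEigenspace _ _ _).2 (by simpa using h))
      simpa using this
    · intro h
      obtain ⟨n, hn⟩ := hN'
      have hcNS : Commute N S := by
        rw [eq_sub_of_add_eq hSN.symm]; exact hS₀.sub_left (Commute.refl S)
      have : ∀ m : ℕ, ((ad k g x) ^ m) w = (N ^ m) w := by
        intro m
        induction m with
        | zero => simp
        | succ m ih =>
          rw [pow_succ', pow_succ', Module.End.mul_apply, Module.End.mul_apply, ih, hSN]
          have e := LinearMap.congr_fun (hcNS.pow_left m) w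
          simp only [Module.End.mul_apply, h, map_zero] at e
          rw [LinearMap.add_apply, ← e, add_zero]
      exact ⟨n, by rw [this, hn]; simp⟩

theorem joint_basis {k g : Type*} [Field k] [IsAlgClosed k] [AddCommGroup g] [Module k g]
    [FiniteDimensional k g] (f h : Module.End k g) (hf : f.IsSemisimple) (hh : h.IsSemisimple)
    (hc : Commute f h) :
    ∃ (β : Set g) (c : Basis β k g) (m s : β → k), ∀ i, f (c i) = m i • c i ∧ h (c i) = s i • c i := by
  have htop := Module.End.iSup_iInf_maxGenEigenspace_eq_top_of_iSup_maxGenEigenspace_eq_top_of_commute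
    (fun b : Bool => if b then f else h) (by
      intro i j hij
      cases i <;> cases j <;> simp_all [hc.symm.eq, Commute, SemiconjBy])
    (fun i => Module.End.iSup_maxGenEigenspace_eq_top _)
  let S : Set g := {x | ∃ m s : k, f x = m • x ∧ h x = s • x}
  have hS : (⊤ : Submodule k g) ≤ Submodule.span k S := by
    rw [← htop]
    refine iSup_le fun χ => fun x hx => Submodule.subset_span ⟨χ true, χ false, ?_, ?_⟩
    · have := (Submodule.mem_iInf _).1 hx true
      simp only [if_true] at this
      rw [hf.isFinitelySemisimple.maxGenEigenspace_eq_eigenspace] at this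
      exact Module.End.mem_eigenspace_iff.1 this
    · have := (Submodule.mem_iInf _).1 hx false
      simp only [Bool.false_eq_true, if_false] at this
      rw [hh.isFinitelySemisimple.maxGenEigenspace_eq_eigenspace] at this
      exact Module.End.mem_eigenspace_iff.1 this
  obtain ⟨β, c, hc, hm⟩ := exists_basis_of_span S hS
  choose m s h using hm
  exact ⟨β, c, m, s, fun i => by rw [hc]; exact h i⟩

theorem exists_fixed_cartan {k g : Type*} [Field k] [IsAlgClosed k] [CharZero k] [LieRing g]
    [LieAlgebra k g] [FiniteDimensional k g] [LieAlgebra.IsKilling k g] (μ : g ≃ₗ⁅k⁆ g)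
    (hμ : μ.toLinearEquiv ∈ Subgroup.closure {e : g ≃ₗ[k] g | ∃ x : g, IsNilpotent (ad k g x) ∧
      (e : g →ₗ[k] g) = ∑ i ∈ Finset.range (Module.finrank k g + 1),
      (i.factorial : k)⁻¹ • (ad k g x) ^ i})
    (hss : Module.End.IsSemisimple (μ.toLinearEquiv : g →ₗ[k] g)) :
    ∃ H : LieSubalgebra k g, H.IsCartanSubalgebra ∧ ∀ h ∈ H, μ h = h := by
  have madd : ∀ a b, μ (a + b) = μ a + μ b := μ.toLinearEquiv.map_add
  have msmul : ∀ (r : k) a, μ (r • a) = r • μ a := μ.toLinearEquiv.map_smul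
  let 𝔨 : LieSubalgebra k g :=
    { carrier := {x | μ x = x}
      add_mem' := fun {a b} ha hb => by
        simp only [Set.mem_setOf_eq] at *; rw [madd, ha, hb]
      zero_mem' := μ.toLinearEquiv.map_zero
      smul_mem' := fun r a ha => by
        simp only [Set.mem_setOf_eq] at *; rw [msmul, ha]
      lie_mem' := fun {a b} ha hb => by
        simp only [Set.mem_setOf_eq] at *
        have := LieEquiv.map_lie μ a b
        change μ ⁅a, b⁆ = ⁅a, b⁆
        rw [this]
        exact congrArg₂ _ ha hb }
  have h𝔨 : ∀ x, x ∈ 𝔨 ↔ μ x = x := fun x => Iff.rfl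
  obtain ⟨x, hx, t, ht, htn, -⟩ := exists_engel 𝔨
  obtain ⟨z, hzs, -, hz0, hzμ, hzw⟩ := jordan_elt (k := k) x
  have hμz : μ z = z := hzμ μ hx
  have ht' : ∀ w, w ∈ t ↔ μ w = w ∧ ⁅z, w⁆ = 0 := fun w => by rw [ht, h𝔨, hzw]
  have hcomm : Commute ((μ.toLinearEquiv : g →ₗ[k] g) : End k g) (ad k g z) := by
    ext w
    change μ ⁅z, w⁆ = ⁅z, μ w⁆
    rw [LieEquiv.map_lie, hμz]
  obtain ⟨κ, c, mm, s, hc⟩ := joint_basis _ _ hss hzs hcomm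
  have hmm : ∀ i, μ (c i) = mm i • c i := fun i => (hc i).1
  have hs : ∀ i, ⁅z, c i⁆ = s i • c i := fun i => (hc i).2
  have : Fintype κ := FiniteDimensional.fintypeBasisIndex c
  -- nondegeneracy
  have hnd : ∀ x ∈ t, (∀ w ∈ t, killingForm k g x w = 0) → x = 0 := by
    intro x hx h
    obtain ⟨hx1, hx2⟩ := (ht' x).1 hx
    have hall : ∀ w, killingForm k g x w = 0 := by
      intro w
      rw [← c.sum_repr w, map_sum]
      refine Finset.sum_eq_zero fun i _ => ?_
      rw [map_smul]
      suffices killingForm k g x (c i) = 0 by rw [this, smul_zero]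
      by_contra hne
      apply hne
      refine h _ ((ht' _).2 ⟨?_, ?_⟩)
      · have h1 := LieAlgebra.killingForm_of_equiv_apply (R := k) μ x (c i)
        rw [hx1, hmm, map_smul, smul_eq_mul] at h1
        have h2 : mm i = 1 := by
          apply mul_right_cancel₀ hne; rw [h1, one_mul]
        rw [hmm, h2, one_smul]
      · have h1 := LieModule.traceForm_apply_lie_apply k g g x z (c i)
        have h3 : ⁅x, z⁆ = 0 := by rw [← lie_skew, hx2, neg_zero]
        rw [h3, hs] at h1
        have h2 : s i * killingForm k g x (c i) = 0 := by
          have : killingForm k g x (s i • c i) = 0 := by rw [killingForm, ← h1]; simp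
          rwa [map_smul] at this
        rw [hs, (mul_eq_zero.1 h2).resolve_right hne, zero_smul]
    have h1 : x ∈ LinearMap.ker (killingForm k g) := by
      rw [LinearMap.mem_ker]; ext w; exact hall w
    have h2 := LieAlgebra.IsKilling.ker_killingForm_eq_bot k g
    rw [h2] at h1
    exact h1
  have hab' : IsLieAbelian t := by
    apply LieModule.isLieAbelian_of_ker_traceForm_eq_bot k t g
    rw [LinearMap.ker_eq_bot']
    intro x hx
    refine Subtype.ext (hnd x x.2 fun w hw => ?_)
    exact LinearMap.congr_fun hx ⟨w, hw⟩
  have hab : ∀ x ∈ t, ∀ y ∈ t, ⁅x, y⁆ = 0 := by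
    intro x hx y hy
    exact congrArg Subtype.val (trivial_lie_zero t t ⟨x, hx⟩ ⟨y, hy⟩)
  have htss : ∀ x ∈ t, (ad k g x).IsSemisimple := by
    intro x hx
    obtain ⟨s', hs's, hs'n, hs'0, hs'μ, -⟩ := jordan_elt (k := k) x
    obtain ⟨hx1, hx2⟩ := (ht' x).1 hx
    have hs't : s' ∈ t := by
      refine (ht' _).2 ⟨hs'μ μ hx1, ?_⟩
      rw [← lie_skew, hs'0 z (by rw [← lie_skew, hx2, neg_zero]), neg_zero]
    have hn : x - s' ∈ t := t.sub_mem hx hs't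
    have h0 : x - s' = 0 := by
      refine hnd _ hn fun w hw => ?_
      rw [killingForm_apply_apply, ← Module.End.mul_eq_comp]
      have hcm : Commute (ad k g (x - s')) (ad k g w) := by
        ext v
        change ⁅x - s', ⁅w, v⁆⁆ = ⁅w, ⁅x - s', v⁆⁆
        rw [leibniz_lie w (x - s') v, hab _ hw _ hn, zero_lie, zero_add]
      exact (LinearMap.isNilpotent_trace_of_isNilpotent (hcm.isNilpotent_mul_right hs'n)).eq_zero
    rw [sub_eq_zero.1 h0]; exact hs's
  -- centralizer of t
  let C : LieSubalgebra k g :=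
    { carrier := {x | ∀ w ∈ t, ⁅w, x⁆ = 0}
      add_mem' := fun {a b} ha hb w hw => by rw [lie_add, ha w hw, hb w hw, add_zero]
      zero_mem' := fun w _ => lie_zero w
      smul_mem' := fun r a ha w hw => by rw [lie_smul, ha w hw, smul_zero]
      lie_mem' := fun {a b} ha hb w hw => by
        rw [leibniz_lie, ha w hw, hb w hw, zero_lie, lie_zero, add_zero] }
  have hC : ∀ x, x ∈ C ↔ ∀ w ∈ t, ⁅w, x⁆ = 0 := fun x => Iff.rfl
  obtain ⟨y, hy, H, hH, hHn, hHs⟩ := exists_engel C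
  have htH : ∀ w ∈ t, w ∈ H := by
    intro w hw
    refine (hH w).2 ⟨fun v hv => hab v hv w hw, 1, ?_⟩
    rw [pow_one, ad_apply, ← lie_skew, (hC y).1 hy w hw, neg_zero]
  have hHc : H.IsCartanSubalgebra := by
    refine ⟨hHn, ?_⟩
    refine le_antisymm ?_ (LieSubalgebra.le_normalizer H)
    intro w hw
    rw [LieSubalgebra.mem_normalizer_iff] at hw
    refine hHs w ?_ hw
    intro τ hτ
    have h1 : ⁅w, τ⁆ ∈ C := ((hH _).1 (hw τ (htH τ hτ))).1
    have h2 : ⁅τ, ⁅τ, w⁆⁆ = 0 := by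
      rw [← lie_skew τ w, lie_neg, (hC _).1 h1 τ hτ, neg_zero]
    have h3 := (htss τ hτ).isFinitelySemisimple.maxGenEigenspace_eq_eigenspace 0
    have h4 : w ∈ (ad k g τ).maxGenEigenspace 0 := by
      rw [Module.End.mem_maxGenEigenspace]
      refine ⟨2, ?_⟩
      rw [zero_smul, sub_zero, pow_two]
      exact h2
    rw [h3, Module.End.mem_eigenspace_iff, zero_smul] at h4
    exact h4
  refine ⟨H, hHc, fun h hh => ?_⟩
  have hle := rank_bound H c μ mm hmm z s hs hμ t.toSubmodule fun x h1 h2 => (ht' x).2 ⟨h1, h2⟩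
  have heq : t.toSubmodule = H.toSubmodule :=
    Submodule.eq_of_le_of_finrank_le (fun w hw => htH w hw) hle
  have : h ∈ t.toSubmodule := by rw [heq]; exact hh
  exact ((ht' h).1 this).1

theorem rootSpace_step {k g : Type*} [Field k] [CharZero k] [LieRing g] [LieAlgebra k g]
    [FiniteDimensional k g] [IsKilling k g] {H : LieSubalgebra k g} [H.IsCartanSubalgebra]
    [LieModule.IsTriangularizable k H g] (α β γ : LieModule.Weight k H g)
    (hα : α.IsNonZero) (hγ : γ.IsNonZero) (hs : (γ : H → k) = α + β)
    {h e f : g} (t : IsSl2Triple h e f) (he : e ∈ rootSpace H α) (hf : f ∈ rootSpace H (-α : H → k))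
    (N : LieSubalgebra k g) (heN : e ∈ N) (hβN : ∀ x ∈ rootSpace H β, x ∈ N) :
    ∀ x ∈ rootSpace H γ, x ∈ N := by
  obtain rfl := t.h_eq_coroot hα he hf
  obtain ⟨x, hx, x0⟩ := (LieModule.chainTop α β).exists_ne_zero
  have prim : t.HasPrimitiveVectorWith x (IsKilling.chainLength α β : k) :=
    have := LieAlgebra.lie_mem_genWeightSpace_of_mem_genWeightSpace he hx
    ⟨x0, (IsKilling.chainLength_smul _ _ hx).symm, by
      rwa [LieModule.genWeightSpace_add_chainTop _ _ hα] at this⟩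
  obtain ⟨p, hp⟩ : ∃ p, LieModule.chainTopCoeff α β = p + 1 := by
    refine Nat.exists_eq_succ_of_ne_zero fun h0 => ?_
    have := LieModule.genWeightSpace_chainTopCoeff_add_one_nsmul_add α β hα
    rw [h0, zero_add, one_smul, ← hs] at this
    exact γ.2 this
  have hle : p + 1 ≤ IsKilling.chainLength α β := by
    rw [← hp]; exact IsKilling.chainTopCoeff_le_chainLength α β
  have htop := LieModule.coe_chainTop' α β
  have m1 := LieAlgebra.toEnd_pow_apply_mem hf hx (p+1)
  have m0 := LieAlgebra.toEnd_pow_apply_mem hf hx p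
  have w1 : (p+1) • (-α : H → k) + (LieModule.chainTop α β : H → k) = β := by
    rw [htop, hp]; simp
  have w0 : p • (-α : H → k) + (LieModule.chainTop α β : H → k) = γ := by
    rw [htop, hp, hs, add_smul, one_smul, smul_neg]; abel
  rw [w1] at m1
  rw [w0] at m0
  have n0 := prim.pow_toEnd_f_ne_zero_of_eq_nat rfl (i := p) (by omega)
  have key := prim.lie_e_pow_succ_toEnd_f p
  intro y hy
  obtain ⟨c, hc⟩ := (finrank_eq_one_iff_of_nonzero' (⟨_, m0⟩ : rootSpace H γ)
    (by simpa using n0)).mp (IsKilling.finrank_rootSpace_eq_one γ hγ) ⟨y, hy⟩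
  have hc' := congrArg Subtype.val hc
  simp only [] at hc'
  have hne : ((p:k)+1) * ((IsKilling.chainLength α β : k) - p) ≠ 0 := by
    refine mul_ne_zero (by exact_mod_cast Nat.succ_ne_zero p) ?_
    rw [sub_ne_zero]
    exact_mod_cast (by omega : IsKilling.chainLength α β ≠ p)
  have hin : (LieModule.toEnd k g g f ^ p) x ∈ N := by
    rw [← inv_smul_smul₀ hne ((LieModule.toEnd k g g f ^ p) x), ← key]
    exact N.smul_mem _ (N.lie_mem heN (hβN _ m1))
  have : y = c • (LieModule.toEnd k g g f ^ p) x := hc'.symm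
  rw [this]
  exact N.smul_mem _ hin

universe uu vv

theorem exists_lieBasis {k : Type uu} {g : Type vv} [Field k] [IsAlgClosed k] [CharZero k] [LieRing g]
    [LieAlgebra k g]
    [FiniteDimensional k g] [IsKilling k g] (H : LieSubalgebra k g) [H.IsCartanSubalgebra] :
    ∃ (ι : Type (max uu vv)) (_ : Fintype ι), Nonempty (LieAlgebra.Basis ι H) := by
  classical
  obtain ⟨b⟩ := RootPairing.nonempty_base (P := IsKilling.rootSystem H)
  have hnz : ∀ i : H.root, (i : LieModule.Weight k H g).IsNonZero := fun i => by
    exact LieSubalgebra.isNonZero_coe_root i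
  have ht : ∀ i : H.root, ∃ e f : g, IsSl2Triple (IsKilling.coroot i.1 : g) e f ∧
      e ∈ rootSpace H i.1 ∧ f ∈ rootSpace H (-i.1 : H → k) := by
    intro i
    obtain ⟨h, e, f, t, he, hf⟩ := IsKilling.exists_isSl2Triple_of_weight_isNonZero (hnz i)
    obtain rfl := t.h_eq_coroot (hnz i) he hf
    exact ⟨e, f, t, he, hf⟩
  choose e f t he hf using ht
  have hHN : ∀ N : LieSubalgebra k g,
      (∀ i : b.support, (IsKilling.coroot i.1.1 : g) ∈ N) → H ≤ N := by
    intro N hN x hx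
    have h1 : (⟨x, hx⟩ : H) ∈ Submodule.span k ((IsKilling.rootSystem H).coroot '' b.support) := by
      rw [b.span_coroot_support, RootPairing.corootSpan,
        RootPairing.IsRootSystem.span_coroot_eq_top]
      trivial
    have h2 : Submodule.span k ((IsKilling.rootSystem H).coroot '' b.support) ≤
        N.toSubmodule.comap H.toSubmodule.subtype := by
      rw [Submodule.span_le]
      rintro _ ⟨i, hi, rfl⟩
      exact hN ⟨i, hi⟩
    exact h2 h1
  refine ⟨b.support, inferInstance, ⟨{
    A := b.cartanMatrix
    h := fun i => (IsKilling.coroot i.1.1 : g)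
    e := fun i => e i.1
    f := fun i => f i.1
    cartan_eq_lieSpan := ?_
    span_ef := ?_
    linInd := ?_
    nondegen := b.cartanMatrix_nondegenerate
    sl2 := fun i => t i.1
    lie_h_h := ?_
    lie_h_e := ?_
    lie_h_f := ?_
    lie_e_f_ne := ?_ }⟩⟩
  · refine le_antisymm (hHN _ fun i => LieSubalgebra.subset_lieSpan ⟨i, rfl⟩) ?_
    rw [LieSubalgebra.lieSpan_le]
    rintro _ ⟨i, rfl⟩
    exact (IsKilling.coroot i.1.1).2
  · set N := LieSubalgebra.lieSpan k g
      (Set.range (fun i : b.support => e i.1) ∪ Set.range (fun i : b.support => f i.1)) with hN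
    have heN : ∀ i ∈ b.support, e i ∈ N := fun i hi =>
      LieSubalgebra.subset_lieSpan (Or.inl ⟨⟨i, hi⟩, rfl⟩)
    have hfN : ∀ i ∈ b.support, f i ∈ N := fun i hi =>
      LieSubalgebra.subset_lieSpan (Or.inr ⟨⟨i, hi⟩, rfl⟩)
    have hH : H ≤ N := hHN N fun i => by
      rw [← (t i.1).lie_e_f]
      exact N.lie_mem (heN _ i.2) (hfN _ i.2)
    have one : ∀ (α : LieModule.Weight k H g), α.IsNonZero → ∀ v ∈ rootSpace H α, v ≠ 0 → v ∈ N →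
        ∀ x ∈ rootSpace H α, x ∈ N := by
      intro α hα v hv v0 hvN x hx
      obtain ⟨c, hc⟩ := (finrank_eq_one_iff_of_nonzero' (⟨_, hv⟩ : rootSpace H α)
        (by simpa using v0)).mp (IsKilling.finrank_rootSpace_eq_one α hα) ⟨x, hx⟩
      have hc' : c • v = x := congrArg Subtype.val hc
      rw [← hc']
      exact N.smul_mem _ hvN
    have hneg : ∀ i : H.root, (-i.1 : LieModule.Weight k H g).IsNonZero := fun i => by
      simpa using hnz i
    have key : ∀ i : H.root, (∀ x ∈ rootSpace H i.1, x ∈ N) ∧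
        (∀ x ∈ rootSpace H ((-i.1 : LieModule.Weight k H g) : H → k), x ∈ N) := by
      intro i
      refine b.induction_add i (p := fun i : H.root => (∀ x ∈ rootSpace H i.1, x ∈ N) ∧
        (∀ x ∈ rootSpace H ((-i.1 : LieModule.Weight k H g) : H → k), x ∈ N)) ?_ ?_ ?_
      · intro i hi
        have : ((IsKilling.rootSystem H).reflectionPerm i i).1 = -i.1 := by
          apply LieModule.Weight.ext
          intro x
          have h1 := (IsKilling.rootSystem H).root_reflectionPerm i i
          rw [RootPairing.reflection_apply_self] at h1
          have := congrArg (fun φ : Dual k H => φ x) h1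
          rw [LieModule.Weight.coe_neg]
          exact this
        rw [this, neg_neg]
        exact ⟨hi.2, hi.1⟩
      · intro i hi
        refine ⟨one _ (hnz i) _ (he i) (t i).e_ne_zero (heN i hi),
          one _ (hneg i) (f i) ?_ (t i).f_ne_zero (hfN i hi)⟩
        rw [LieModule.Weight.coe_neg]
        exact hf i
      · intro i j l hl hi hj
        have hl' : (l.1 : H → k) = j.1 + i.1 := by
          funext x
          have := congrArg (fun φ : Dual k H => φ x) hl
          rw [add_comm]
          exact this
        refine ⟨rootSpace_step j.1 i.1 l.1 (hnz j) (hnz l) hl' (t j) (he j) (hf j) N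
          (heN j hj) hi.1, rootSpace_step (-j.1) (-i.1) (-l.1) (hneg j) (hneg l) ?_
          (t j).symm ?_ ?_ N (hfN j hj) hi.2⟩
        · simp only [LieModule.Weight.coe_neg, hl']; abel
        · rw [LieModule.Weight.coe_neg]; exact hf j
        · rw [LieModule.Weight.coe_neg, neg_neg]; exact he j
    let N' : LieSubmodule k H g :=
      { N.toSubmodule with lie_mem := fun {x m} hm => N.lie_mem (hH x.2) hm }
    have hle : H.toLieSubmodule ⊔ (⨆ α : LieModule.Weight k H g, ⨆ (_ : α.IsNonZero),
        rootSpace H α) ≤ N' := by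
      refine sup_le (fun x hx => hH hx) (iSup₂_le fun α hα x hx => ?_)
      exact (key ⟨α, by simpa using hα⟩).1 x hx
    rw [LieAlgebra.cartan_sup_iSup_rootSpace_eq_top] at hle
    rw [eq_top_iff]
    intro x _
    exact hle (LieSubmodule.mem_top x)
  · have := b.linearIndepOn_coroot
    have h2 := LinearIndependent.map' this H.toSubmodule.subtype (Submodule.ker_subtype _)
    exact h2
  · intro i j
    have : ⁅IsKilling.coroot i.1.1, IsKilling.coroot j.1.1⁆ = 0 := trivial_lie_zero _ _ _ _
    exact congrArg Subtype.val this
  · intro i j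
    have := IsKilling.lie_eq_smul_of_mem_rootSpace (he i.1) (IsKilling.coroot j.1.1)
    rw [← Int.cast_smul_eq_zsmul k]
    have h2 := b.algebraMap_cartanMatrixIn_apply ℤ i j
    change algebraMap ℤ k (b.cartanMatrix i j) = _ at h2
    rw [eq_intCast] at h2
    rw [h2]
    exact this
  · intro i j
    have := IsKilling.lie_eq_smul_of_mem_rootSpace (hf i.1) (IsKilling.coroot j.1.1)
    rw [← Int.cast_smul_eq_zsmul k, Int.cast_neg]
    have h2 := b.algebraMap_cartanMatrixIn_apply ℤ i j
    change algebraMap ℤ k (b.cartanMatrix i j) = _ at h2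
    rw [eq_intCast] at h2
    rw [h2]
    exact this
  · intro i j hij
    have h1 := LieAlgebra.lie_mem_genWeightSpace_of_mem_genWeightSpace (he i.1) (hf j.1)
    by_contra h0
    have hne : rootSpace H ((i.1.1 : H → k) + -j.1.1) ≠ ⊥ := by
      intro hb
      have h1 : _ ∈ rootSpace H ((i.1.1 : H → k) + -j.1.1) := h1
      rw [hb] at h1
      exact h0 (by simpa using h1)
    apply b.sub_notMem_range_root i.2 j.2
    let w : LieModule.Weight k H g := ⟨_, hne⟩
    have hw : w.IsNonZero := by
      intro hz
      apply hij
      have hz' : (w : H → k) = 0 := hz.eq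
      apply Subtype.ext
      apply Subtype.ext
      apply LieModule.Weight.ext
      intro x
      have := congrFun hz' x
      have h3 : (i.1.1 : H → k) x + - (j.1.1 : H → k) x = 0 := this
      exact eq_of_sub_eq_zero (by rw [sub_eq_add_neg]; exact h3)
    refine ⟨⟨w, by simpa using hw⟩, ?_⟩
    ext x
    change (i.1.1 : H → k) x + - (j.1.1 : H → k) x = (i.1.1 : H → k) x - (j.1.1 : H → k) x
    rw [sub_eq_add_neg]

theorem ideal_meets_cartan {k g : Type*} [Field k] [IsAlgClosed k] [CharZero k] [LieRing g]
    [LieAlgebra k g]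
    [FiniteDimensional k g] [IsKilling k g] (H : LieSubalgebra k g) [H.IsCartanSubalgebra]
    (I : LieIdeal k g) (hI : ∀ y ∈ I, y ∈ H → y = 0) : I = ⊥ := by
  have h := IsKilling.lieIdeal_eq_inf_cartan_sup_biSup_rootSpace (H := H) I
  have h1 : I.restr H ⊓ H.toLieSubmodule = ⊥ := by
    rw [LieSubmodule.eq_bot_iff]
    intro x hx
    exact hI x hx.1 hx.2
  have h2 : (⨆ (α : H.root) (_ : rootSpace H α.val ≤ I.restr H), rootSpace H α.val) = ⊥ := by
    rw [eq_bot_iff]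
    refine iSup₂_le fun α hα => ?_
    exfalso
    obtain ⟨h, e, f, t, he, hf⟩ := IsKilling.exists_isSl2Triple_of_weight_isNonZero
      (LieSubalgebra.isNonZero_coe_root α)
    obtain rfl := t.h_eq_coroot (LieSubalgebra.isNonZero_coe_root α) he hf
    apply t.h_ne_zero
    refine hI _ ?_ (IsKilling.coroot α.1).2
    rw [← t.lie_e_f, ← lie_skew]
    exact I.neg_mem (I.lie_mem (hα he))
  rw [h1, h2, sup_bot_eq] at h
  rw [LieSubmodule.eq_bot_iff]
  intro x hx
  have : x ∈ I.restr H := hx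
  rw [h] at this
  simpa using this

theorem exists_chevalley {k g : Type*} [Field k] [IsAlgClosed k] [CharZero k] [LieRing g]
    [LieAlgebra k g]
    [FiniteDimensional k g] [IsKilling k g] (H : LieSubalgebra k g) [H.IsCartanSubalgebra] :
    ∃ ω : g ≃ₗ⁅k⁆ g, ∀ x ∈ H, ω x = -x := by
  obtain ⟨ι, _, ⟨b⟩⟩ := exists_lieBasis H
  let S : Set (g × g) := Set.range (fun i => (b.e i, b.f i)) ∪ Set.range (fun i => (b.f i, b.e i))
  let P : LieSubalgebra k (g × g) := LieSubalgebra.lieSpan k (g × g) S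
  have heP : ∀ i, (b.e i, b.f i) ∈ P := fun i => LieSubalgebra.subset_lieSpan (Or.inl ⟨i, rfl⟩)
  have hfP : ∀ i, (b.f i, b.e i) ∈ P := fun i => LieSubalgebra.subset_lieSpan (Or.inr ⟨i, rfl⟩)
  have hfe : ∀ i, ⁅b.f i, b.e i⁆ = - b.h i := fun i => by
    rw [← lie_skew, (b.sl2 i).lie_e_f]
  have hhP : ∀ i, (b.h i, - b.h i) ∈ P := fun i => by
    have := P.lie_mem (heP i) (hfP i)
    have h2 : ⁅(b.e i, b.f i), (b.f i, b.e i)⁆ = (b.h i, - b.h i) := by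
      ext
      · exact (b.sl2 i).lie_e_f
      · exact hfe i
    rwa [h2] at this
  let C : LieSubalgebra k P := LieSubalgebra.lieSpan k P (Set.range fun i => ⟨_, hhP i⟩)
  have hHab := b.isLieAbelian_cartan
  have hab : ∀ x ∈ H, ∀ y ∈ H, ⁅x, y⁆ = 0 := fun x hx y hy => by
    have : ⁅(⟨x, hx⟩ : H), (⟨y, hy⟩ : H)⁆ = 0 := trivial_lie_zero _ _ _ _
    exact congrArg Subtype.val this
  let B : LieAlgebra.Basis ι C :=
    { A := b.A
      h := fun i => ⟨_, hhP i⟩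
      e := fun i => ⟨_, heP i⟩
      f := fun i => ⟨_, hfP i⟩
      cartan_eq_lieSpan := rfl
      span_ef := by
        have : (Set.range (fun i => (⟨_, heP i⟩ : P)) ∪ Set.range (fun i => (⟨_, hfP i⟩ : P)))
          = Subtype.val ⁻¹' S := by
          ext x; simp [S, Subtype.ext_iff]
        rw [this]
        exact LieSubalgebra.lieSpan_lieSpan_coe_preimage
      linInd := .of_comp P.toSubmodule.subtype <| .of_comp (LinearMap.fst k g g) b.linInd
      nondegen := b.nondegen
      sl2 := fun i =>
       { h_ne_zero := by simp [Subtype.ext_iff, (b.sl2 i).h_ne_zero]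
         lie_e_f := by simp [Subtype.ext_iff, (b.sl2 i).lie_e_f, hfe]
         lie_h_e_nsmul := by
          simp [Subtype.ext_iff, (b.sl2 i).lie_h_e_nsmul, (b.sl2 i).lie_h_f_nsmul]
         lie_h_f_nsmul := by
          simp [Subtype.ext_iff, (b.sl2 i).lie_h_e_nsmul, (b.sl2 i).lie_h_f_nsmul] }
      lie_h_h := fun i j => by simp [Subtype.ext_iff, b.lie_h_h]
      lie_h_e := fun i j => by simp [Subtype.ext_iff, b.lie_h_e, b.lie_h_f]
      lie_h_f := fun i j => by simp [Subtype.ext_iff, b.lie_h_e, b.lie_h_f]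
      lie_e_f_ne := fun i j hij => by
        have : ⁅b.f i, b.e j⁆ = 0 := by rw [← lie_skew, b.lie_e_f_ne j i hij.symm, neg_zero]
        simp [Subtype.ext_iff, b.lie_e_f_ne i j hij, this] }
  have hC := B.isCartanSubalgebra
  have hCmem : ∀ c ∈ C, c.1.1 ∈ H ∧ c.1.2 = - c.1.1 := by
    let Q : LieSubalgebra k P :=
      { carrier := {c | c.1.1 ∈ H ∧ c.1.2 = - c.1.1}
        add_mem' := by
          rintro a c ⟨h1, h2⟩ ⟨h3, h4⟩
          refine ⟨H.add_mem h1 h3, ?_⟩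
          change a.1.2 + c.1.2 = - (a.1.1 + c.1.1)
          rw [h2, h4]; abel
        zero_mem' := ⟨H.zero_mem, neg_zero.symm⟩
        smul_mem' := by
          rintro r a ⟨h1, h2⟩
          refine ⟨H.smul_mem r h1, ?_⟩
          change r • a.1.2 = - (r • a.1.1)
          rw [h2, smul_neg]
        lie_mem' := by
          rintro a c ⟨h1, h2⟩ ⟨h3, h4⟩
          refine ⟨H.lie_mem h1 h3, ?_⟩
          change ⁅a.1.2, c.1.2⁆ = - ⁅a.1.1, c.1.1⁆
          rw [h2, h4, neg_lie, lie_neg, hab _ h1 _ h3]; simp }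
    have : C ≤ Q := by
      rw [LieSubalgebra.lieSpan_le]
      rintro _ ⟨i, rfl⟩
      refine ⟨?_, rfl⟩
      change b.h i ∈ H
      exact (b.h' i).2
    exact fun c hc => this hc
  have hHP : ∀ x ∈ H, (x, -x) ∈ P := by
    intro x hx
    replace hx : x ∈ Submodule.span k (Set.range b.h) := by
      rw [← b.coe_cartan_eq_span]; exact hx
    induction hx using Submodule.span_induction with
    | mem x h => obtain ⟨i, rfl⟩ := h; exact hhP i
    | zero => rw [neg_zero]; exact P.zero_mem
    | add x y hx hy h1 h2 =>
      have := P.add_mem h1 h2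
      rw [neg_add]
      exact this
    | smul a x hx h1 =>
      have := P.smul_mem a h1
      rw [← smul_neg]
      exact this
  let p₁ : P →ₗ⁅k⁆ g := (LieHom.fst k g g).comp P.incl
  let p₂ : P →ₗ⁅k⁆ g := (LieHom.snd k g g).comp P.incl
  have s1 : Function.Surjective p₁ := by
    rw [← LieHom.range_eq_top, eq_top_iff, ← b.span_ef, LieSubalgebra.lieSpan_le]
    rintro _ (⟨i, rfl⟩ | ⟨i, rfl⟩)
    · exact ⟨⟨_, heP i⟩, rfl⟩
    · exact ⟨⟨_, hfP i⟩, rfl⟩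
  have s2 : Function.Surjective p₂ := by
    rw [← LieHom.range_eq_top, eq_top_iff, ← b.span_ef, LieSubalgebra.lieSpan_le]
    rintro _ (⟨i, rfl⟩ | ⟨i, rfl⟩)
    · exact ⟨⟨_, hfP i⟩, rfl⟩
    · exact ⟨⟨_, heP i⟩, rfl⟩
  let I : LieIdeal k g :=
    { carrier := {y | ((0 : g), y) ∈ P}
      add_mem' := by
        intro a c h1 h2
        have := P.add_mem h1 h2
        simpa using this
      zero_mem' := P.zero_mem
      smul_mem' := by
        intro r a h
        have := P.smul_mem r h
        simpa using this
      lie_mem := by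
        intro x m hm
        obtain ⟨z, rfl⟩ := s2 x
        have := P.lie_mem z.2 hm
        have h2 : ⁅z.1, ((0 : g), m)⁆ = (0, ⁅p₂ z, m⁆) := by
          ext
          · exact lie_zero _
          · rfl
        rwa [h2] at this }
  have hI : I = ⊥ := by
    apply ideal_meets_cartan H
    intro y hy hyH
    have hy : ((0 : g), y) ∈ P := hy
    have : (⟨_, hy⟩ : P) ∈ C := by
      rw [← hC.self_normalizing, LieSubalgebra.mem_normalizer_iff]
      intro c hc
      obtain ⟨h1, h2⟩ := hCmem c hc
      have : ⁅(⟨_, hy⟩ : P), c⁆ = 0 := by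
        apply Subtype.ext
        ext
        · exact zero_lie _
        · change ⁅y, c.1.2⁆ = 0
          rw [h2, lie_neg, hab _ hyH _ h1, neg_zero]
      rw [this]; exact C.zero_mem
    have := (hCmem _ this).2
    simpa using this
  have i1 : Function.Injective p₁ := by
    rw [injective_iff_map_eq_zero]
    rintro ⟨⟨x, y⟩, h⟩ hx
    have hx : x = 0 := hx
    subst hx
    have : y ∈ I := h
    rw [hI] at this
    have : y = 0 := by simpa using this
    subst this
    rfl
  have hfr : finrank k P = finrank k g :=
    (LinearEquiv.ofBijective (p₁ : P →ₗ[k] g) ⟨i1, s1⟩).finrank_eq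
  have i2 : Function.Injective p₂ :=
    (LinearMap.injective_iff_surjective_of_finrank_eq_finrank (f := (p₂ : P →ₗ[k] g)) hfr).2 s2
  let E1 := LieEquiv.ofBijective p₁ ⟨i1, s1⟩
  let E2 := LieEquiv.ofBijective p₂ ⟨i2, s2⟩
  refine ⟨E1.symm.trans E2, fun x hx => ?_⟩
  have : E1.symm x = ⟨_, hHP x hx⟩ := by
    have : x = E1 ⟨_, hHP x hx⟩ := rfl
    conv_lhs => rw [this]
    exact E1.symm_apply_apply _
  change E2 (E1.symm x) = _
  rw [this]
  rfl

theorem invol_of_neg {k g : Type*} [Field k] [IsAlgClosed k] [CharZero k] [LieRing g]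
    [LieAlgebra k g]
    [FiniteDimensional k g] [IsKilling k g] (H : LieSubalgebra k g) [H.IsCartanSubalgebra]
    (φ : g ≃ₗ⁅k⁆ g) (hφ : ∀ x ∈ H, φ x = -x) (x : g) : φ (φ x) = x := by
  have hsm : ∀ (c : k) (x : g), φ (c • x) = c • φ x := fun c x => φ.toLinearEquiv.map_smul c x
  have hng : ∀ (x : g), φ (- x) = - φ x := fun x => φ.toLinearEquiv.map_neg x
  have had : ∀ (x y : g), φ (x + y) = φ x + φ y := fun x y => φ.toLinearEquiv.map_add x y
  have hz : φ 0 = 0 := φ.toLinearEquiv.map_zero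
  have hli : ∀ (x y : g), φ ⁅x, y⁆ = ⁅φ x, φ y⁆ := fun x y => LieEquiv.map_lie φ x y
  have hmap : ∀ (α : H → k) (x : g), x ∈ rootSpace H α → φ x ∈ rootSpace H (-α) := by
    intro α x hx
    refine (LieModule.mem_genWeightSpace _ _ _).mpr fun h => ⟨1, ?_⟩
    have h1 := IsKilling.lie_eq_smul_of_mem_rootSpace hx h
    have h1 : ⁅(h : g), x⁆ = α h • x := h1
    have h2 := hli h x
    rw [h1, hsm, hφ _ h.2, neg_lie] at h2
    simp only [pow_one, LinearMap.sub_apply, LieModule.toEnd_apply_apply, Pi.neg_apply,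
      LinearMap.smul_apply]
    change ⁅(h : g), φ x⁆ - (- α h) • φ x = 0
    rw [neg_smul, h2]; abel
  have one : ∀ (α : LieModule.Weight k H g), α.IsNonZero → ∀ v ∈ rootSpace H α, v ≠ 0 →
        ∀ x ∈ rootSpace H α, ∃ c : k, x = c • v := by
    intro α hα v hv v0 x hx
    obtain ⟨c, hc⟩ := (finrank_eq_one_iff_of_nonzero' (⟨_, hv⟩ : rootSpace H α)
      (by simpa using v0)).mp (IsKilling.finrank_rootSpace_eq_one α hα) ⟨x, hx⟩
    have hc' : c • v = x := congrArg Subtype.val hc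
    exact ⟨c, hc'.symm⟩
  let N' : LieSubmodule k H g :=
    { carrier := {x | φ (φ x) = x}
      add_mem' := by
        intro a b (h1 : _ = _) (h2 : _ = _)
        change φ (φ (a + b)) = a + b
        rw [had, had, h1, h2]
      zero_mem' := by change φ (φ 0) = 0; rw [hz, hz]
      smul_mem' := by
        intro r a (h1 : _ = _)
        change φ (φ (r • a)) = r • a
        rw [hsm, hsm, h1]
      lie_mem := by
        intro h m (h1 : _ = _)
        change φ (φ ⁅(h : g), m⁆) = ⁅(h : g), m⁆
        rw [hli, hli, hφ _ h.2, hng, hφ _ h.2, neg_neg, h1] }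
  have hle : H.toLieSubmodule ⊔ (⨆ α : LieModule.Weight k H g, ⨆ (_ : α.IsNonZero),
        rootSpace H α) ≤ N' := by
    refine sup_le (fun x hx => ?_) (iSup₂_le fun α hα x hx => ?_)
    · have hx : x ∈ H := hx
      change φ (φ x) = x
      rw [hφ x hx, hng, hφ x hx, neg_neg]
    · obtain ⟨h, e, f, t, he, hf⟩ := IsKilling.exists_isSl2Triple_of_weight_isNonZero hα
      obtain rfl := t.h_eq_coroot hα he hf
      have hα' : (-α).IsNonZero := by simpa using hα
      obtain ⟨c, hc⟩ := one (-α) hα' f (by rw [LieModule.Weight.coe_neg]; exact hf) t.f_ne_zero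
        (φ e) (by rw [LieModule.Weight.coe_neg]; exact hmap _ _ he)
      obtain ⟨d, hd⟩ := one α hα e he t.e_ne_zero (φ f) (by
        have := hmap _ _ hf
        rwa [neg_neg] at this)
      obtain ⟨r, rfl⟩ := one α hα e he t.e_ne_zero x hx
      have h1 := hli e f
      rw [t.lie_e_f, hφ _ (IsKilling.coroot α).2, hc, hd, smul_lie, lie_smul, ← lie_skew,
        t.lie_e_f, smul_smul, smul_neg, neg_inj] at h1
      have hcd : c * d = 1 := by
        have h2 : (1 - c * d) • (IsKilling.coroot α : g) = 0 := by
          rw [sub_smul, one_smul, ← h1, sub_self]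
        rcases smul_eq_zero.1 h2 with h3 | h3
        · exact (sub_eq_zero.1 h3).symm
        · exact absurd h3 t.h_ne_zero
      change φ (φ (r • e)) = r • e
      rw [hsm, hsm, hc, hsm, hd, smul_smul c d, hcd, one_smul]
  rw [LieAlgebra.cartan_sup_iSup_rootSpace_eq_top] at hle
  exact hle (LieSubmodule.mem_top x)

/-- Every inner automorphism of `g` that is semisimple as a linear
endomorphism is the product of two involutions of maximal rank. -/
theorem inner_semisimple_eq_product_of_maxRank (mu : g ≃ₗ⁅k⁆ g)
    (hinner : IsInnerAut k g mu)
    (hss : Module.End.IsSemisimple (mu.toLinearEquiv : g →ₗ[k] g)) :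
    ∃ θ θ' : g ≃ₗ⁅k⁆ g, IsInvolution k g θ ∧ IsInvolution k g θ' ∧
      IsMaxRank k g θ ∧ IsMaxRank k g θ' ∧ ∀ x, mu x = θ (θ' x) := by
  obtain ⟨H, hH, hfix⟩ := exists_fixed_cartan mu hinner hss
  obtain ⟨w, hw⟩ := exists_chevalley H
  have hinv := invol_of_neg H w hw
  have hw2 : ∀ x ∈ H, (mu.trans w) x = -x := by
    intro x hx
    change w (mu x) = -x
    rw [hfix x hx, hw x hx]
  refine ⟨w, mu.trans w, hinv, invol_of_neg H _ hw2, ⟨H, hH, ?_⟩, ⟨H, hH, ?_⟩, ?_⟩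
  · intro x hx
    rw [eigSub, Module.End.mem_eigenspace_iff, neg_one_smul]
    exact hw x hx
  · intro x hx
    rw [eigSub, Module.End.mem_eigenspace_iff, neg_one_smul]
    exact hw2 x hx
  · intro x
    exact (hinv (mu x)).symm
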